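/- arXiv:2301.09752 — 2 statements merged into one kernel-verified Lean document; each statement's English description precedes it below -/
import Mathlib

section
/- There is a computable function F : ℚ × ℚ × ℚ × ℚ × ℚ × ℚ × ℚ → Bool such that for all rationals a1, b1, a2, b2, c, x0, t: if the two-interval PAM f defined by these parameters maps [0,1) ∩ ℚ into [0,1) ∩ ℚ, is injective on [0,1) ∩ ℚ, satisfies the twist condition, a2 < 0, the cutpoint satisfies a2 + b2 < c ≤ a2*c + b2 (i.e. c lies in f([c,1))), and x0, t ∈ [0,1) ∩ ℚ, then F (a1, b1, a2, b2, c, x0, t) = true if and only if there exists n : ℕ with f^[n] x0 = t. -/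
/-- The two-interval piecewise affine map on `[0,1) ∩ ℚ` given by rationals
`a1, b1, a2, b2, c`. -/
def pam2 (a1 b1 a2 b2 c : ℚ) (x : ℚ) : ℚ :=
  if 0 ≤ x ∧ x < c then a1 * x + b1
  else if c ≤ x ∧ x < 1 then a2 * x + b2
  else 0

open Encodable

theorem cfind {α : Type*} [Primcodable α] {p : α → ℕ → Bool} (hp : Computable₂ p)
    (h : ∀ a, ∃ n, p a n = true) : Computable (fun a => Nat.find (h a)) := by
  have h1 : Partrec (fun a => Nat.rfind (fun n => (Part.some (p a n)))) :=
    Partrec.rfind hp.partrec₂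
  refine Partrec.of_eq_tot h1 ?_
  intro a
  refine Nat.mem_rfind.2 ⟨?_, ?_⟩
  · simpa using (Nat.find_spec (h a)).symm
  · intro m hm
    have := Nat.find_min (h a) hm
    simpa using this

abbrev enc0 : ℚ → ℕ := @encode ℚ Rat.instEncodable

theorem enc0_eq (q : ℚ) : enc0 q = Nat.pair (encode q.num) q.den := by
  rfl

theorem encInt (z : ℤ) : encode z = if 0 ≤ z then 2 * z.toNat else 2 * (-z).toNat - 1 := by
  rcases z with n | n
  · simp; rfl
  · have h : encode (Int.negSucc n) = 2 * n + 1 := rfl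
    rw [h, if_neg (by omega)]
    omega

instance instInf : Infinite (Set.range enc0) :=
    Infinite.of_injective _ (Equiv.ofInjective _ (@encode_injective ℚ Rat.instEncodable)).injective

theorem enc0_ofNat (n : ℕ) : enc0 (Denumerable.ofNat ℚ n) =
   ((@Nat.Subtype.ofNat (Set.range enc0) (@decidableRangeEncode ℚ Rat.instEncodable) _ n : Set.range enc0) : ℕ) := by
  have h : Denumerable.ofNat ℚ n = (@equivRangeEncode ℚ Rat.instEncodable).symm
    (@Nat.Subtype.ofNat (Set.range enc0) (@decidableRangeEncode ℚ Rat.instEncodable) _ n) := by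
    apply Option.some_injective
    rw [← Denumerable.decode_eq_ofNat]
    rfl
  rw [h]
  set s := (@Nat.Subtype.ofNat (Set.range enc0) (@decidableRangeEncode ℚ Rat.instEncodable) _ n)
  have := (@equivRangeEncode ℚ Rat.instEncodable).apply_symm_apply s
  exact congrArg Subtype.val this

def nabs (m : ℕ) : ℕ := (m.unpair.1 + 1) / 2

theorem mem_enc0 (m : ℕ) : m ∈ Set.range enc0 ↔
    0 < m.unpair.2 ∧ Nat.Coprime (nabs m) m.unpair.2 := by
  constructor
  · rintro ⟨q, rfl⟩
    have hn : nabs (enc0 q) = q.num.natAbs := by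
      rw [nabs, enc0_eq, Nat.unpair_pair, encInt]
      dsimp only
      split_ifs <;> omega
    rw [hn, enc0_eq, Nat.unpair_pair]
    exact ⟨q.pos, q.reduced⟩
  · rintro ⟨h1, h2⟩
    obtain ⟨z, hz⟩ : ∃ z : ℤ, encode z = m.unpair.1 :=
      ⟨Denumerable.ofNat ℤ m.unpair.1, Denumerable.encode_ofNat _⟩
    have hn : nabs m = z.natAbs := by
      rw [nabs, ← hz, encInt]
      split_ifs <;> omega
    rw [hn] at h2
    refine ⟨⟨z, m.unpair.2, h1.ne', h2⟩, ?_⟩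
    rw [enc0_eq]
    simp [hz]

theorem cop_iff (a d : ℕ) : (0 < d ∧ Nat.Coprime a d) ↔
    0 < d ∧ ∀ x < d + 1, x = 1 ∨ ¬ (a % x = 0 ∧ d % x = 0) := by
  refine and_congr_right fun hd => ?_
  constructor
  · intro h x _
    by_cases hx : a % x = 0 ∧ d % x = 0
    · left
      exact Nat.eq_one_of_dvd_coprimes h (Nat.dvd_of_mod_eq_zero hx.1) (Nat.dvd_of_mod_eq_zero hx.2)
    · exact Or.inr hx
  · intro h
    have hle := Nat.le_of_dvd hd (Nat.gcd_dvd_right a d)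
    rcases h (Nat.gcd a d) (by omega) with h | h
    · exact h
    · exfalso
      exact h ⟨Nat.mod_eq_zero_of_dvd (Nat.gcd_dvd_left a d),
        Nat.mod_eq_zero_of_dvd (Nat.gcd_dvd_right a d)⟩

theorem prim_u1 : Primrec (fun m : ℕ => m.unpair.1) := Primrec.fst.comp Primrec.unpair
theorem prim_u2 : Primrec (fun m : ℕ => m.unpair.2) := Primrec.snd.comp Primrec.unpair
theorem prim_nabs : Primrec nabs :=
  Primrec.nat_div.comp (Primrec.succ.comp prim_u1) (Primrec.const 2)

theorem prim_mem : PrimrecPred (fun m => m ∈ Set.range enc0) := by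
  have h0 : PrimrecRel (fun (x : ℕ) (m : ℕ) => x = 1 ∨ ¬ (nabs m % x = 0 ∧ m.unpair.2 % x = 0)) := by
    refine PrimrecPred.primrecRel (p := fun y : ℕ × ℕ => y.1 = 1 ∨ ¬ (nabs y.2 % y.1 = 0 ∧ y.2.unpair.2 % y.1 = 0)) ?_
    refine PrimrecPred.or (Primrec.eq.comp Primrec.fst (Primrec.const 1)) (PrimrecPred.not
      (PrimrecPred.and (Primrec.eq.comp ?_ (Primrec.const 0)) (Primrec.eq.comp ?_ (Primrec.const 0))))
    · exact Primrec.nat_mod.comp (prim_nabs.comp Primrec.snd) Primrec.fst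
    · exact Primrec.nat_mod.comp (prim_u2.comp Primrec.snd) Primrec.fst
  have h1 := PrimrecRel.forall_lt h0
  have h2 : PrimrecPred (fun m : ℕ => 0 < m.unpair.2 ∧ ∀ x < m.unpair.2 + 1, x = 1 ∨ ¬ (nabs m % x = 0 ∧ m.unpair.2 % x = 0)) :=
    PrimrecPred.and (Primrec.nat_lt.comp (Primrec.const 0) prim_u2)
      (h1.comp (Primrec.succ.comp prim_u2) Primrec.id)
  refine h2.of_eq fun m => ?_
  rw [mem_enc0, cop_iff]

open Classical in
theorem comp_next : ∃ s : ℕ → ℕ, Computable s ∧ ∀ x : Set.range enc0,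
    s x = (@Nat.Subtype.succ (Set.range enc0) _ (@decidableRangeEncode ℚ Rat.instEncodable) x : ℕ) := by
  have hex : ∀ y : ℕ, ∃ n, decide (y + n + 1 ∈ Set.range enc0) = true := by
    intro y
    have hinf : (Set.range enc0).Infinite := Set.infinite_coe_iff.1 instInf
    obtain ⟨m, hm, hlt⟩ := hinf.exists_gt y
    exact ⟨m - y - 1, by rw [decide_eq_true_iff]; convert hm using 1; omega⟩
  have hc : Computable₂ (fun y n : ℕ => decide (y + n + 1 ∈ Set.range enc0)) := by
    refine Primrec.to_comp ?_
    exact (prim_mem.decide).comp (Primrec.succ.comp (Primrec.nat_add.comp Primrec.fst Primrec.snd))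
  refine ⟨fun y => y + Nat.find (hex y) + 1, ?_, ?_⟩
  · exact Computable.succ.comp (Primrec.nat_add.to_comp.comp Computable.id (cfind hc hex))
  · intro x
    unfold Nat.Subtype.succ
    simp

theorem comp_enc0 : Computable enc0 := by
  obtain ⟨s, hs, hs2⟩ := comp_next
  have h1 : Computable (fun n : ℕ => (Nat.rec (enc0 (Denumerable.ofNat ℚ 0)) (fun _ ih => s ih) n : ℕ)) :=
    Computable.nat_rec (f := fun n : ℕ => n) (g := fun _ => enc0 (Denumerable.ofNat ℚ 0)) (h := fun _ p => s p.2)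
     Computable.id (Computable.const _)
      (hs.comp (Computable.snd.comp Computable.snd))
  have h2 : Computable (fun q : ℚ => (Nat.rec (enc0 (Denumerable.ofNat ℚ 0)) (fun _ ih => s ih) (@encode ℚ Primcodable.toEncodable q) : ℕ)) :=
    h1.comp Computable.encode
  refine h2.of_eq fun q => ?_
  have h3 : ∀ n : ℕ, (Nat.rec (enc0 (Denumerable.ofNat ℚ 0)) (fun _ ih => s ih) n : ℕ) = enc0 (Denumerable.ofNat ℚ n) := by
    intro n
    induction n with
    | zero => rfl
    | succ n ih =>
      have : (Nat.rec (enc0 (Denumerable.ofNat ℚ 0)) (fun _ ih => s ih) (n + 1) : ℕ) = s (Nat.rec (enc0 (Denumerable.ofNat ℚ 0)) (fun _ ih => s ih) n : ℕ) := rfl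
      rw [this, ih, enc0_ofNat, enc0_ofNat, hs2]
      rfl
  rw [h3]
  exact congrArg enc0 (Denumerable.ofNat_encode q)

/-- positive part, negative part, denominator -/
def qp (q : ℚ) : ℕ := q.num.toNat
def qn (q : ℚ) : ℕ := (-q.num).toNat

theorem comp_den : Computable (fun q : ℚ => q.den) := by
  refine (prim_u2.to_comp.comp comp_enc0).of_eq fun q => ?_
  simp [enc0_eq]

theorem comp_encnum : Computable (fun q : ℚ => encode q.num) := by
  refine (prim_u1.to_comp.comp comp_enc0).of_eq fun q => ?_
  simp [enc0_eq]

theorem comp_qp : Computable qp := by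
  have h : Primrec (fun i : ℕ => if i % 2 = 0 then i / 2 else 0) :=
    Primrec.ite (Primrec.eq.comp (Primrec.nat_mod.comp Primrec.id (Primrec.const 2)) (Primrec.const 0))
      (Primrec.nat_div.comp Primrec.id (Primrec.const 2)) (Primrec.const 0)
  refine (h.to_comp.comp comp_encnum).of_eq fun q => ?_
  rw [qp, encInt]
  split_ifs <;> omega

theorem comp_qn : Computable qn := by
  have h : Primrec (fun i : ℕ => if i % 2 = 0 then 0 else (i + 1) / 2) :=
    Primrec.ite (Primrec.eq.comp (Primrec.nat_mod.comp Primrec.id (Primrec.const 2)) (Primrec.const 0))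
      (Primrec.const 0) (Primrec.nat_div.comp Primrec.succ (Primrec.const 2))
  refine (h.to_comp.comp comp_encnum).of_eq fun q => ?_
  rw [qn, encInt]
  split_ifs <;> omega

theorem q_repr (q : ℚ) : q = ((qp q : ℚ) - qn q) / q.den := by
  have h : q.num = (qp q : ℤ) - qn q := by unfold qp qn; omega
  have h2 : (q.num : ℚ) = (qp q : ℚ) - qn q := by rw [h]; push_cast; rfl
  rw [← h2, Rat.num_div_den]

section ops
variable {α : Type*} [Primcodable α]

theorem c_nadd {f g : α → ℕ} (hf : Computable f) (hg : Computable g) :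
    Computable (fun a => f a + g a) := Primrec.nat_add.to_comp.comp hf hg
theorem c_nmul {f g : α → ℕ} (hf : Computable f) (hg : Computable g) :
    Computable (fun a => f a * g a) := Primrec.nat_mul.to_comp.comp hf hg
theorem c_nle {f g : α → ℕ} (hf : Computable f) (hg : Computable g) :
    Computable (fun a => decide (f a ≤ g a)) := Primrec.nat_le.decide.to_comp.comp hf hg
theorem c_neq {f g : α → ℕ} (hf : Computable f) (hg : Computable g) :
    Computable (fun a => decide (f a = g a)) := Primrec.eq.decide.to_comp.comp hf hg
theorem c_and {f g : α → Bool} (hf : Computable f) (hg : Computable g) :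
    Computable (fun a => f a && g a) := Primrec.and.to_comp.comp hf hg
theorem c_or {f g : α → Bool} (hf : Computable f) (hg : Computable g) :
    Computable (fun a => f a || g a) := Primrec.or.to_comp.comp hf hg
theorem c_not {f : α → Bool} (hf : Computable f) :
    Computable (fun a => ! f a) := Primrec.not.to_comp.comp hf

theorem c_qle {f g : α → ℚ} (hf : Computable f) (hg : Computable g) :
    Computable (fun a => decide (f a ≤ g a)) := by
  have h : Computable (fun a => decide (qp (f a) * (g a).den + qn (g a) * (f a).den
      ≤ qp (g a) * (f a).den + qn (f a) * (g a).den)) :=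
    c_nle (c_nadd (c_nmul (comp_qp.comp hf) (comp_den.comp hg))
      (c_nmul (comp_qn.comp hg) (comp_den.comp hf)))
      (c_nadd (c_nmul (comp_qp.comp hg) (comp_den.comp hf))
      (c_nmul (comp_qn.comp hf) (comp_den.comp hg)))
  refine h.of_eq fun a => ?_
  rw [decide_eq_decide]
  conv_rhs => rw [q_repr (f a), q_repr (g a)]
  have h1 : (0 : ℚ) < (f a).den := by exact_mod_cast (f a).pos
  have h2 : (0 : ℚ) < (g a).den := by exact_mod_cast (g a).pos
  rw [div_le_div_iff₀ h1 h2, ← Nat.cast_le (α := ℚ)]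
  push_cast
  constructor <;> intro h <;> linarith

theorem c_qlt {f g : α → ℚ} (hf : Computable f) (hg : Computable g) :
    Computable (fun a => decide (f a < g a)) := by
  refine (c_not (c_qle hg hf)).of_eq fun a => ?_
  by_cases h : f a < g a
  · simp [h, not_le.2 h]
  · simp [h, not_lt.1 h]

theorem c_qeq {f g : α → ℚ} (hf : Computable f) (hg : Computable g) :
    Computable (fun a => decide (f a = g a)) := Primrec.eq.decide.to_comp.comp hf hg

theorem c_mk {p n d : α → ℕ} (hp : Computable p) (hn : Computable n) (hd : Computable d)
    (hd0 : ∀ a, d a ≠ 0) :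
    Computable (fun a => ((p a : ℚ) - n a) / d a) := by
  let r : α → ℕ → Bool := fun a k => decide
    (qp (Denumerable.ofNat ℚ k) * d a + n a * (Denumerable.ofNat ℚ k).den =
      p a * (Denumerable.ofNat ℚ k).den + qn (Denumerable.ofNat ℚ k) * d a)
  have hk : Computable (fun y : α × ℕ => Denumerable.ofNat ℚ y.2) :=
    (Primrec.ofNat ℚ).to_comp.comp Computable.snd
  have h1 := (hp.comp (Computable.fst (α := α) (β := ℕ)))
  have h2 := (hn.comp (Computable.fst (α := α) (β := ℕ)))
  have h3 := (hd.comp (Computable.fst (α := α) (β := ℕ)))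
  have hr : Computable₂ r :=
    c_neq (c_nadd (c_nmul (comp_qp.comp hk) h3) (c_nmul h2 (comp_den.comp hk)))
      (c_nadd (c_nmul h1 (comp_den.comp hk)) (c_nmul (comp_qn.comp hk) h3))
  have hspec : ∀ a k, r a k = true ↔ Denumerable.ofNat ℚ k = ((p a : ℚ) - n a) / d a := by
    intro a k
    simp only [r, decide_eq_true_iff]
    conv_rhs => rw [q_repr (Denumerable.ofNat ℚ k)]
    have h1 : ((Denumerable.ofNat ℚ k).den : ℚ) ≠ 0 := by exact_mod_cast (Denumerable.ofNat ℚ k).pos.ne'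
    have h2 : (d a : ℚ) ≠ 0 := by exact_mod_cast hd0 a
    rw [div_eq_div_iff h1 h2, ← Nat.cast_inj (R := ℚ)]
    push_cast
    constructor <;> intro h <;> linarith
  have hex : ∀ a, ∃ k, r a k = true := fun a =>
    ⟨@encode ℚ Primcodable.toEncodable (((p a : ℚ) - n a) / d a),
      (hspec a _).2 (Denumerable.ofNat_encode _)⟩
  refine ((Primrec.ofNat ℚ).to_comp.comp (cfind hr hex)).of_eq fun a => ?_
  exact (hspec a _).1 (Nat.find_spec (hex a))

theorem c_qadd {f g : α → ℚ} (hf : Computable f) (hg : Computable g) :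
    Computable (fun a => f a + g a) := by
  have h := c_mk (c_nadd (c_nmul (comp_qp.comp hf) (comp_den.comp hg))
      (c_nmul (comp_qp.comp hg) (comp_den.comp hf)))
    (c_nadd (c_nmul (comp_qn.comp hf) (comp_den.comp hg))
      (c_nmul (comp_qn.comp hg) (comp_den.comp hf)))
    (c_nmul (comp_den.comp hf) (comp_den.comp hg))
    (fun a => (Nat.mul_pos (f a).pos (g a).pos).ne')
  refine h.of_eq fun a => ?_
  conv_rhs => rw [q_repr (f a), q_repr (g a)]
  have h1 : ((f a).den : ℚ) ≠ 0 := by exact_mod_cast (f a).pos.ne'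
  have h2 : ((g a).den : ℚ) ≠ 0 := by exact_mod_cast (g a).pos.ne'
  push_cast
  field_simp
  ring

theorem c_qmul {f g : α → ℚ} (hf : Computable f) (hg : Computable g) :
    Computable (fun a => f a * g a) := by
  have h := c_mk (c_nadd (c_nmul (comp_qp.comp hf) (comp_qp.comp hg))
      (c_nmul (comp_qn.comp hf) (comp_qn.comp hg)))
    (c_nadd (c_nmul (comp_qp.comp hf) (comp_qn.comp hg))
      (c_nmul (comp_qn.comp hf) (comp_qp.comp hg)))
    (c_nmul (comp_den.comp hf) (comp_den.comp hg))
    (fun a => (Nat.mul_pos (f a).pos (g a).pos).ne')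
  refine h.of_eq fun a => ?_
  conv_rhs => rw [q_repr (f a), q_repr (g a)]
  have h1 : ((f a).den : ℚ) ≠ 0 := by exact_mod_cast (f a).pos.ne'
  have h2 : ((g a).den : ℚ) ≠ 0 := by exact_mod_cast (g a).pos.ne'
  push_cast
  field_simp
  ring

theorem c_ite {f g : α → ℚ} {c : α → Prop} [DecidablePred c] (hc : Computable fun a => decide (c a))
    (hf : Computable f) (hg : Computable g) :
    Computable (fun a => if c a then f a else g a) := by
  refine (Computable.cond hc hf hg).of_eq fun a => ?_
  by_cases h : c a <;> simp [h]

theorem c_fst {β γ : Type*} [Primcodable β] [Primcodable γ] {f : α → β × γ} (hf : Computable f) :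
    Computable (fun a => (f a).1) := Computable.fst.comp hf
theorem c_snd {β γ : Type*} [Primcodable β] [Primcodable γ] {f : α → β × γ} (hf : Computable f) :
    Computable (fun a => (f a).2) := Computable.snd.comp hf
end ops

section dyn
variable (a1 b1 a2 b2 c t : ℚ)

/-- the affine branch selected by `y`, applied to `q` -/
def br (y q : ℚ) : ℚ := if y < c then a1 * q + b1 else a2 * q + b2

def hm (y : ℚ) : ℚ := br a1 b1 a2 b2 c y y

def same (y q : ℚ) : Prop := (y < c ∧ q ≤ c) ∨ (c ≤ y ∧ c ≤ q)
def nb (y q : ℚ) : Prop := (t < y ∧ t ≤ q) ∨ (y < t ∧ q ≤ t)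
def JJ (y q z : ℚ) : Prop := ∃ s : ℚ, 0 < s ∧ s ≤ 1 ∧ z = q + s * (y - q)

variable {a1 b1 a2 b2 c t}

theorem JJ_step {y q z : ℚ} (hs : same c y q) (hz : JJ y q z) :
    JJ (br a1 b1 a2 b2 c y y) (br a1 b1 a2 b2 c y q) (hm a1 b1 a2 b2 c z) := by
  obtain ⟨s, h0, h1, rfl⟩ := hz
  refine ⟨s, h0, h1, ?_⟩
  unfold hm br
  rcases hs with ⟨h2, h3⟩ | ⟨h2, h3⟩
  · have : q + s * (y - q) < c := by nlinarith
    rw [if_pos this, if_pos h2, if_pos h2]; ring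
  · have : ¬ q + s * (y - q) < c := by nlinarith
    rw [if_neg this, if_neg (not_lt.2 h2), if_neg (not_lt.2 h2)]; ring

theorem JJ_ne {y q z : ℚ} (hs : nb t y q) (hz : JJ y q z) : z ≠ t := by
  obtain ⟨s, h0, h1, rfl⟩ := hz
  rcases hs with ⟨h2, h3⟩ | ⟨h2, h3⟩
  · have : t < q + s * (y - q) := by nlinarith
    exact this.ne'
  · have : q + s * (y - q) < t := by nlinarith
    exact this.ne

/-- simultaneous step of a point and its anchor -/
def TT (a1 b1 a2 b2 c : ℚ) (z : ℚ × ℚ) : ℚ × ℚ :=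
  (br a1 b1 a2 b2 c z.1 z.1, br a1 b1 a2 b2 c z.1 z.2)

def stp (c t : ℚ) (z : ℚ × ℚ) : Bool :=
  ((decide (z.1 < c) && decide (z.2 ≤ c)) || (decide (c ≤ z.1) && decide (c ≤ z.2))) &&
  ((decide (t < z.1) && decide (t ≤ z.2)) || (decide (z.1 < t) && decide (z.2 ≤ t)))

def fin4 (z w : ℚ × ℚ) : Bool :=
  decide (w.2 = z.2) && ((decide (z.2 < w.1) && decide (w.1 ≤ z.1)) ||
    ((decide (z.1 ≤ w.1) && decide (w.1 < z.2)) || (decide (z.1 = z.2) && decide (w.1 = z.2))))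

def cert (a1 b1 a2 b2 c t : ℚ) (z : ℚ × ℚ) : Bool :=
  stp c t z && (stp c t (TT a1 b1 a2 b2 c z) &&
  (stp c t (TT a1 b1 a2 b2 c (TT a1 b1 a2 b2 c z)) &&
  (stp c t (TT a1 b1 a2 b2 c (TT a1 b1 a2 b2 c (TT a1 b1 a2 b2 c z))) &&
  fin4 z (TT a1 b1 a2 b2 c (TT a1 b1 a2 b2 c (TT a1 b1 a2 b2 c (TT a1 b1 a2 b2 c z)))))))

theorem stp_iff {z : ℚ × ℚ} : stp c t z = true ↔ same c z.1 z.2 ∧ nb t z.1 z.2 := by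
  simp [stp, same, nb]

theorem JJ_TT {w : ℚ × ℚ} {z : ℚ} (hs : stp c t w = true) (hz : JJ w.1 w.2 z) :
    JJ (TT a1 b1 a2 b2 c w).1 (TT a1 b1 a2 b2 c w).2 (hm a1 b1 a2 b2 c z) :=
  JJ_step (stp_iff.1 hs).1 hz

theorem fin4_J {w w' : ℚ × ℚ} {z : ℚ} (h : fin4 w w' = true) (hz : JJ w'.1 w'.2 z) :
    JJ w.1 w.2 z := by
  obtain ⟨y, q⟩ := w
  obtain ⟨y', q'⟩ := w'
  simp only [fin4, Bool.and_eq_true, Bool.or_eq_true, decide_eq_true_iff] at h hz ⊢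
  obtain ⟨rfl, h⟩ := h
  obtain ⟨s, h0, h1, rfl⟩ := hz
  rcases h with ⟨h, h'⟩ | ⟨h, h'⟩ | ⟨h, h'⟩
  · have hp : 0 < y - q' := by linarith
    have hp' : 0 < y' - q' := by linarith
    refine ⟨s * ((y' - q') / (y - q')), by positivity, ?_, ?_⟩
    · exact mul_le_one₀ h1 (by positivity) ((div_le_one hp).2 (by linarith))
    · field_simp
  · have hp : 0 < q' - y := by linarith
    have hp' : 0 < q' - y' := by linarith
    refine ⟨s * ((q' - y') / (q' - y)), by positivity, ?_, ?_⟩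
    · exact mul_le_one₀ h1 (by positivity) ((div_le_one hp).2 (by linarith))
    · field_simp
      ring
  · exact ⟨s, h0, h1, by rw [h, h']⟩

theorem cert_sound {w : ℚ × ℚ} (h : cert a1 b1 a2 b2 c t w = true) :
    ∀ n : ℕ, ∀ z, JJ w.1 w.2 z → (hm a1 b1 a2 b2 c)^[n] z ≠ t := by
  simp only [cert, Bool.and_eq_true] at h
  obtain ⟨h0, h1, h2, h3, h4⟩ := h
  intro n
  induction n using Nat.strong_induction_on with
  | _ n ih =>
    intro z hz
    have j1 := JJ_TT (a1 := a1) (b1 := b1) (a2 := a2) (b2 := b2) h0 hz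
    have j2 := JJ_TT (a1 := a1) (b1 := b1) (a2 := a2) (b2 := b2) h1 j1
    have j3 := JJ_TT (a1 := a1) (b1 := b1) (a2 := a2) (b2 := b2) h2 j2
    have j4 := JJ_TT (a1 := a1) (b1 := b1) (a2 := a2) (b2 := b2) h3 j3
    match n with
    | 0 => exact JJ_ne (stp_iff.1 h0).2 hz
    | 1 => exact JJ_ne (stp_iff.1 h1).2 j1
    | 2 => exact JJ_ne (stp_iff.1 h2).2 j2
    | 3 => exact JJ_ne (stp_iff.1 h3).2 j3
    | n + 4 => exact ih n (by omega) _ (fin4_J h4 j4)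

end dyn


section complete

def okP (a1 b1 a2 b2 c x0 : ℚ) : Prop :=
  0 < c ∧ c < 1 ∧ a2 < 0 ∧ 0 ≤ a2 + b2 ∧ a2 * c + b2 < 1 ∧ c ≤ a2 * c + b2 ∧ a2 * c + b2 < b1 ∧
  a2 * c + b2 ≤ a1 * c + b1 ∧ b1 < 1 ∧ a1 * c + b1 ≤ 1 ∧ (a1 < 0 ∨ 0 < a1) ∧ 0 ≤ x0 ∧ x0 < 1

variable {a1 b1 a2 b2 c x0 t : ℚ}

theorem left_gt (h : okP a1 b1 a2 b2 c x0) {x : ℚ} (h0 : 0 ≤ x) (h1 : x < c) :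
    a2 * c + b2 < a1 * x + b1 := by
  obtain ⟨k1, k2, k3, k4, k5, k6, k7, k8, k9, k10, k11, k12, k13⟩ := h
  have : 0 < c * (a1 * x + b1 - (a2 * c + b2)) := by
    have e : c * (a1 * x + b1 - (a2 * c + b2)) =
      x * (a1 * c + b1 - (a2 * c + b2)) + (c - x) * (b1 - (a2 * c + b2)) := by ring
    rw [e]
    have i1 : 0 ≤ x * (a1 * c + b1 - (a2 * c + b2)) := mul_nonneg h0 (by linarith)
    have i2 : 0 < (c - x) * (b1 - (a2 * c + b2)) := mul_pos (by linarith) (by linarith)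
    linarith
  have := (mul_pos_iff_of_pos_left k1).1 this
  linarith

theorem left_lt (h : okP a1 b1 a2 b2 c x0) {x : ℚ} (h0 : 0 ≤ x) (h1 : x < c) :
    a1 * x + b1 < 1 := by
  obtain ⟨k1, k2, k3, k4, k5, k6, k7, k8, k9, k10, k11, k12, k13⟩ := h
  have : 0 < c * (1 - (a1 * x + b1)) := by
    have e : c * (1 - (a1 * x + b1)) = x * (1 - (a1 * c + b1)) + (c - x) * (1 - b1) := by ring
    rw [e]
    have i1 : 0 ≤ x * (1 - (a1 * c + b1)) := mul_nonneg h0 (by linarith)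
    have i2 : 0 < (c - x) * (1 - b1) := mul_pos (by linarith) (by linarith)
    linarith
  have := (mul_pos_iff_of_pos_left k1).1 this
  linarith

theorem hm_left {x : ℚ} (h1 : x < c) : hm a1 b1 a2 b2 c x = a1 * x + b1 := by
  simp [hm, br, h1]
theorem hm_right {x : ℚ} (h1 : c ≤ x) : hm a1 b1 a2 b2 c x = a2 * x + b2 := by
  simp [hm, br, not_lt.2 h1]

theorem hm_maps (h : okP a1 b1 a2 b2 c x0) {x : ℚ} (h0 : 0 ≤ x) (h1 : x < 1) :
    0 ≤ hm a1 b1 a2 b2 c x ∧ hm a1 b1 a2 b2 c x < 1 := by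
  rcases lt_or_ge x c with hx | hx
  · rw [hm_left hx]
    have i1 := left_gt h h0 hx
    have i2 := left_lt h h0 hx
    obtain ⟨k1, k2, k3, k4, k5, k6, k7, k8, k9, k10, k11, k12, k13⟩ := h
    exact ⟨by linarith, i2⟩
  · rw [hm_right hx]
    obtain ⟨k1, k2, k3, k4, k5, k6, k7, k8, k9, k10, k11, k12, k13⟩ := h
    exact ⟨by nlinarith, by nlinarith⟩

theorem orb_mem (h : okP a1 b1 a2 b2 c x0) (n : ℕ) :
    0 ≤ (hm a1 b1 a2 b2 c)^[n] x0 ∧ (hm a1 b1 a2 b2 c)^[n] x0 < 1 := by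
  induction n with
  | zero => exact ⟨h.2.2.2.2.2.2.2.2.2.2.2.1, h.2.2.2.2.2.2.2.2.2.2.2.2⟩
  | succ n ih =>
    rw [Function.iterate_succ_apply']
    exact hm_maps h ih.1 ih.2

theorem eventually_two (h : okP a1 b1 a2 b2 c x0) (x : ℕ → ℚ)
    (hx : ∀ n, x (n + 1) = hm a1 b1 a2 b2 c (x n)) (hb : ∀ n, 0 ≤ x n ∧ x n < 1) :
    ∃ k, ∀ n, k ≤ n → (x (n + 2) < c ↔ x n < c) := by
  have hL : ∀ n, x n < c → a2 * c + b2 < x (n + 1) := fun n hn => by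
    rw [hx, hm_left hn]; exact left_gt h (hb n).1 hn
  have hR : ∀ n, c ≤ x n → x (n + 1) = a2 * x n + b2 := fun n hn => by
    rw [hx, hm_right hn]
  obtain ⟨k1, k2, k3, k4, k5, k6, k7, k8, k9, k10, k11, k12, k13⟩ := h
  have hL' : ∀ n, x n < c → c ≤ x (n + 1) := fun n hn => by
    have := hL n hn
    linarith
  rcases le_or_gt (-1) a2 with ha | ha
  · have key : ∀ n, c ≤ x n → c ≤ x (n + 1) → c ≤ x (n + 2) := by
      intro n h0 h1
      have e1 := hR n h0
      have e2 := hR (n + 1) h1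
      have : x (n + 1 + 1) - c = (x (n + 1) - c) * (1 + a2) + (-a2) * (x n - c) := by
        rw [e2]
        have : b2 = x (n + 1) - a2 * x n := by linarith
        rw [this]; ring
      have i1 : 0 ≤ (x (n + 1) - c) * (1 + a2) := mul_nonneg (by linarith) (by linarith)
      have i2 : 0 ≤ (-a2) * (x n - c) := mul_nonneg (by linarith) (by linarith)
      show c ≤ x (n + 1 + 1)
      linarith
    by_cases hk : ∃ k, c ≤ x k ∧ c ≤ x (k + 1)
    · obtain ⟨k, hk1, hk2⟩ := hk
      have all : ∀ m, c ≤ x (k + m) ∧ c ≤ x (k + m + 1) := by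
        intro m
        induction m with
        | zero => exact ⟨hk1, hk2⟩
        | succ m ih => exact ⟨ih.2, key _ ih.1 ih.2⟩
      refine ⟨k, fun n hn => ?_⟩
      obtain ⟨m, rfl⟩ := Nat.exists_eq_add_of_le hn
      have i1 := (all m).1
      have i2 := (all (m + 1)).2
      have i2 : c ≤ x (k + m + 2) := i2
      constructor <;> intro hh <;> linarith
    · push Not at hk
      refine ⟨0, fun n _ => ?_⟩
      constructor
      · intro h2
        by_contra h0
        have h1 := hk n (not_lt.1 h0)
        have := hL' (n + 1) h1
        have : c ≤ x (n + 2) := this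
        linarith
      · intro h0
        exact hk (n + 1) (hL' n h0)
  · have key : ∀ n, x n < c → x (n + 2) < c := by
      intro n h0
      have e1 := hL n h0
      have e2 := hR (n + 1) (hL' n h0)
      show x (n + 1 + 1) < c
      rw [e2]
      have i1 : a2 * x (n + 1) < a2 * (a2 * c + b2) := mul_lt_mul_of_neg_left e1 k3
      have i2 : a2 * (a2 * c + b2) + b2 - c = (1 + a2) * (a2 * c + b2 - c) := by ring
      have i3 : (1 + a2) * (a2 * c + b2 - c) ≤ 0 :=
        mul_nonpos_of_nonpos_of_nonneg (by linarith) (by linarith)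
      linarith
    by_cases hk : ∃ k, x k < c
    · obtain ⟨k, hk⟩ := hk
      have all : ∀ m, x (k + 2 * m) < c := by
        intro m
        induction m with
        | zero => exact hk
        | succ m ih => exact key _ ih
      have all2 : ∀ m, c ≤ x (k + 2 * m + 1) := fun m => hL' _ (all m)
      refine ⟨k, fun n hn => ?_⟩
      obtain ⟨m, rfl⟩ := Nat.exists_eq_add_of_le hn
      rcases Nat.even_or_odd' m with ⟨j, rfl | rfl⟩
      · have i1 := all j
        have i2 := all (j + 1)
        exact ⟨fun _ => i1, fun _ => i2⟩
      · have i1 : c ≤ x (k + (2 * j + 1)) := all2 j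
        have i2 : c ≤ x (k + (2 * j + 1) + 2) := all2 (j + 1)
        constructor <;> intro hh <;> linarith
    · push Not at hk
      refine ⟨0, fun n _ => ?_⟩
      have i1 := hk n
      have i2 := hk (n + 2)
      constructor <;> intro hh <;> linarith

theorem pow_small {α : ℚ} (h0 : 0 < α) (h1 : α < 1) (D : ℚ) {ε : ℚ} (hε : 0 < ε) :
    ∃ M : ℕ, ∀ m, M ≤ m → |α ^ m * D| < ε := by
  have hp : 0 < |D| + 1 := by positivity
  obtain ⟨M, hM⟩ := exists_pow_lt_of_lt_one (div_pos hε hp) h1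
  refine ⟨M, fun m hm => ?_⟩
  have i1 : α ^ m ≤ α ^ M := pow_le_pow_of_le_one h0.le h1.le hm
  have i2 : α ^ m < ε / (|D| + 1) := lt_of_le_of_lt i1 hM
  have i3 : 0 < α ^ m := by positivity
  rw [lt_div_iff₀ hp] at i2
  rw [abs_mul, abs_of_pos i3]
  nlinarith [abs_nonneg D]

theorem cert_of_seq {y Q : ℕ → ℚ} {n : ℕ}
    (hy : ∀ i, y (i + 1) = br a1 b1 a2 b2 c (y i) (y i))
    (hQ : ∀ i, Q (i + 1) = br a1 b1 a2 b2 c (y i) (Q i))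
    (hst : ∀ i < 4, same c (y (n + i)) (Q (n + i)) ∧ nb t (y (n + i)) (Q (n + i)))
    (hf : fin4 (y n, Q n) (y (n + 4), Q (n + 4)) = true) :
    cert a1 b1 a2 b2 c t (y n, Q n) = true := by
  have hT : ∀ i, TT a1 b1 a2 b2 c (y i, Q i) = (y (i + 1), Q (i + 1)) := fun i => by
    rw [TT, hy, hQ]
  simp only [cert, hT, Bool.and_eq_true]
  exact ⟨stp_iff.2 (hst 0 (by norm_num)), stp_iff.2 (hst 1 (by norm_num)),
    stp_iff.2 (hst 2 (by norm_num)), stp_iff.2 (hst 3 (by norm_num)), hf⟩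

theorem complete_two (ha1 : a1 ≠ 0) (ha2 : a2 ≠ 0) (y : ℕ → ℚ)
    (hy : ∀ n, y (n + 1) = br a1 b1 a2 b2 c (y n) (y n)) (hb : ∀ n, 0 ≤ y n ∧ y n < 1)
    (hp : ∀ n, y (n + 2) < c ↔ y n < c) (hne : ∀ n, y n ≠ t) :
    ∃ n q, cert a1 b1 a2 b2 c t (y n, q) = true := by
  set A : ℕ → ℚ := fun n => if y n < c then a1 else a2 with hA
  set B : ℕ → ℚ := fun n => if y n < c then b1 else b2 with hB
  have hbr : ∀ n q, br a1 b1 a2 b2 c (y n) q = A n * q + B n := by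
    intro n q
    simp only [br, hA, hB]
    split_ifs <;> rfl
  have hA0 : ∀ n, A n ≠ 0 := by
    intro n
    simp only [hA]
    split_ifs <;> assumption
  have hA2 : ∀ n, A (n + 2) = A n := fun n => by simp only [hA, hp]
  have hB2 : ∀ n, B (n + 2) = B n := fun n => by simp only [hB, hp]
  have hAA : ∀ n, A (n + 1) * A n = A 1 * A 0 := by
    intro n
    induction n with
    | zero => rfl
    | succ n ih => rw [← ih, hA2]; ring
  set α : ℚ := (A 1 * A 0) ^ 2 with hα
  have hα0 : 0 < α := by
    have := mul_ne_zero (hA0 1) (hA0 0)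
    positivity
  have hD4 : ∀ D : ℕ → ℚ, (∀ n, D (n + 1) = A n * D n) → ∀ n, D (n + 4) = α * D n := by
    intro D hD n
    rw [hD (n + 3), hD (n + 2), hD (n + 1), hD n, hA2 (n + 1), hA2 n, hα, ← hAA n]
    ring
  rcases lt_or_ge α 1 with h1 | h1
  · -- contracting case
    set β : ℚ := A 3 * (A 2 * (A 1 * B 0 + B 1) + B 2) + B 3 with hβ
    set q : ℚ := β / (1 - α) with hq
    let Q : ℕ → ℚ := fun n => Nat.rec q (fun i v => A i * v + B i) n
    have hQ0 : Q 0 = q := rfl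
    have hQs : ∀ n, Q (n + 1) = A n * Q n + B n := fun n => rfl
    have hQ4 : Q 4 = Q 0 := by
      have e : Q 4 = α * q + β := by
        have s4 : Q 4 = A 3 * Q 3 + B 3 := hQs 3
        have s3 : Q 3 = A 2 * Q 2 + B 2 := hQs 2
        have s2 : Q 2 = A 1 * Q 1 + B 1 := hQs 1
        have s1 : Q 1 = A 0 * q + B 0 := hQs 0
        have t2 : A 2 = A 0 := hA2 0
        have t3 : A 3 = A 1 := hA2 1
        rw [s4, s3, s2, s1, hβ, hα, t3, t2]
        ring
      rw [e, hQ0]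
      have : (1 - α) ≠ 0 := by linarith
      have : q * (1 - α) = β := div_mul_cancel₀ _ this
      linarith
    have hQp : ∀ n, Q (n + 4) = Q n := by
      intro n
      induction n with
      | zero => exact hQ4
      | succ n ih =>
        have e : Q (n + 1 + 4) = A (n + 4) * Q (n + 4) + B (n + 4) := hQs (n + 4)
        rw [e, ih, hQs n, hA2 (n + 2), hA2 n, hB2 (n + 2), hB2 n]
    have hD : ∀ n, y (n + 4) - Q (n + 4) = α * (y n - Q n) :=
      hD4 (fun n => y n - Q n) (fun n => by
        show y (n + 1) - Q (n + 1) = A n * (y n - Q n)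
        rw [hy, hbr, hQs]; ring)
    have hDm : ∀ i m, y (4 * m + i) = Q i + α ^ m * (y i - Q i) ∧ Q (4 * m + i) = Q i ∧
        (y (4 * m + i) < c ↔ y i < c) := by
      intro i m
      induction m with
      | zero => simp
      | succ m ih =>
        have e : 4 * (m + 1) + i = 4 * m + i + 4 := by ring
        have e3 : Q (4 * (m + 1) + i) = Q i := by rw [e, hQp, ih.2.1]
        refine ⟨?_, e3, ?_⟩
        · have := hD (4 * m + i)
          rw [← e, e3, ih.2.1, ih.1] at this
          rw [pow_succ]
          linarith
        · rw [e]
          exact (hp (4 * m + i + 2)).trans ((hp (4 * m + i)).trans ih.2.2)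
    have hsame : ∀ i m, same c (y (4 * m + i)) (Q i) := by
      intro i m
      rcases lt_or_ge (y i) c with hi | hi
      · left
        refine ⟨(hDm i m).2.2.2 hi, ?_⟩
        refine not_lt.1 fun hc => ?_
        obtain ⟨M, hM⟩ := pow_small hα0 h1 (y i - Q i) (sub_pos.2 hc)
        have i1 := (abs_lt.1 (hM M le_rfl)).1
        have i2 := (hDm i M).1
        have i3 := (hDm i M).2.2.2 hi
        linarith
      · right
        refine ⟨not_lt.1 fun hh => not_lt.2 hi ((hDm i m).2.2.1 hh), ?_⟩
        refine not_lt.1 fun hc => ?_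
        obtain ⟨M, hM⟩ := pow_small hα0 h1 (y i - Q i) (sub_pos.2 hc)
        have i1 := (abs_lt.1 (hM M le_rfl)).2
        have i2 := (hDm i M).1
        have i3 := not_lt.1 fun hh => not_lt.2 hi ((hDm i M).2.2.1 hh)
        linarith
    have hnb : ∀ i, ∃ M, ∀ m, M ≤ m → nb t (y (4 * m + i)) (Q i) := by
      intro i
      rcases lt_trichotomy t (Q i) with hi | hi | hi
      · obtain ⟨M, hM⟩ := pow_small hα0 h1 (y i - Q i) (sub_pos.2 hi)
        refine ⟨M, fun m hm => Or.inl ⟨?_, hi.le⟩⟩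
        have i1 := (abs_lt.1 (hM m hm)).1
        have i2 := (hDm i m).1
        linarith
      · refine ⟨0, fun m _ => ?_⟩
        rcases lt_or_gt_of_ne (hne (4 * m + i)) with hh | hh
        · exact Or.inr ⟨hh, hi.ge⟩
        · exact Or.inl ⟨hh, hi.le⟩
      · obtain ⟨M, hM⟩ := pow_small hα0 h1 (y i - Q i) (sub_pos.2 hi)
        refine ⟨M, fun m hm => Or.inr ⟨?_, hi.le⟩⟩
        have i1 := (abs_lt.1 (hM m hm)).2
        have i2 := (hDm i m).1
        linarith
    choose M hM using hnb
    set m := M 0 + M 1 + M 2 + M 3 with hm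
    refine ⟨4 * m, Q (4 * m), cert_of_seq hy (fun i => by rw [hbr, hQs]) ?_ ?_⟩
    · intro i hi
      rw [(hDm i m).2.1]
      refine ⟨hsame i m, hM i m ?_⟩
      interval_cases i <;> omega
    · have e1 := hD (4 * m)
      have e2 := hQp (4 * m)
      rw [e2] at e1 ⊢
      simp only [fin4, Bool.and_eq_true, Bool.or_eq_true, decide_eq_true_iff]
      refine ⟨trivial, ?_⟩
      rcases lt_trichotomy (y (4 * m)) (Q (4 * m)) with h | h | h
      · right; left
        constructor <;> nlinarith
      · right; right
        exact ⟨h, by rw [h] at e1; linarith⟩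
      · left
        constructor <;> nlinarith
  · -- non-contracting case: the orbit is periodic
    have e4 : y 4 = y 0 := by
      by_contra hne4
      have hδ : ∀ n, y (n + 4 + 4) - y (n + 4) = α * (y (n + 4) - y n) := by
        intro n
        refine hD4 (fun n => y (n + 4) - y n) (fun n => ?_) n
        show y (n + 4 + 1) - y (n + 1) = A n * (y (n + 4) - y n)
        rw [hy (n + 4), hy n, hbr, hbr, hA2 (n + 2), hA2 n, hB2 (n + 2), hB2 n]
        ring
      have hδm : ∀ m, y (4 * m + 4) - y (4 * m) = α ^ m * (y 4 - y 0) := by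
        intro m
        induction m with
        | zero => simp
        | succ m ih =>
          have := hδ (4 * m)
          rw [ih] at this
          rw [pow_succ, mul_add, mul_one, this]; ring
      have hmono : ∀ m : ℕ, (m : ℚ) * |y 4 - y 0| ≤ |y (4 * m) - y 0| ∧
          0 ≤ (y (4 * m) - y 0) * (y 4 - y 0) := by
        intro m
        induction m with
        | zero => simp
        | succ m ih =>
          have hpw : 1 ≤ α ^ m := one_le_pow₀ h1
          have e : y (4 * (m + 1)) - y 0 = (y (4 * m) - y 0) + α ^ m * (y 4 - y 0) := by
            rw [← hδm m]
            show y (4 * m + 4) - y 0 = _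
            ring
          rw [e]
          push_cast
          rcases lt_or_gt_of_ne hne4 with hh | hh
          · have hu : y 4 - y 0 < 0 := by linarith
            have hv : y (4 * m) - y 0 ≤ 0 := by
              by_contra hc
              have := mul_neg_of_pos_of_neg (not_le.1 hc) hu
              linarith [ih.2]
            rw [abs_of_neg hu, abs_of_nonpos hv] at ih
            have hw : α ^ m * (y 4 - y 0) ≤ y 4 - y 0 := by nlinarith
            rw [abs_of_neg hu, abs_of_nonpos (by linarith)]
            exact ⟨by linarith [ih.1], by nlinarith⟩
          · have hu : 0 < y 4 - y 0 := by linarith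
            have hv : 0 ≤ y (4 * m) - y 0 := by
              by_contra hc
              have := mul_neg_of_neg_of_pos (not_le.1 hc) hu
              linarith [ih.2]
            rw [abs_of_pos hu, abs_of_nonneg hv] at ih
            have hw : y 4 - y 0 ≤ α ^ m * (y 4 - y 0) := by nlinarith
            rw [abs_of_pos hu, abs_of_nonneg (by linarith)]
            exact ⟨by linarith [ih.1], by nlinarith⟩
      have hpos : 0 < |y 4 - y 0| := abs_pos.2 (sub_ne_zero.2 hne4)
      obtain ⟨m, hm⟩ := exists_nat_gt (1 / |y 4 - y 0|)
      rw [div_lt_iff₀ hpos] at hm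
      have i1 := (hmono m).1
      have i2 : |y (4 * m) - y 0| < 1 := by
        have := hb (4 * m)
        have := hb 0
        rw [abs_lt]; constructor <;> linarith
      linarith
    refine ⟨0, y 0, cert_of_seq (Q := y) hy hy ?_ ?_⟩
    · intro i _
      constructor
      · rcases lt_or_ge (y (0 + i)) c with h | h
        · exact Or.inl ⟨h, h.le⟩
        · exact Or.inr ⟨h, h⟩
      · rcases lt_or_gt_of_ne (hne (0 + i)) with h | h
        · exact Or.inr ⟨h, h.le⟩
        · exact Or.inl ⟨h, h.le⟩
    · simp [fin4, e4]

theorem cert_complete (h : okP a1 b1 a2 b2 c x0)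
    (hne : ∀ n, (hm a1 b1 a2 b2 c)^[n] x0 ≠ t) :
    ∃ n q, cert a1 b1 a2 b2 c t ((hm a1 b1 a2 b2 c)^[n] x0, q) = true := by
  have hx : ∀ n, (hm a1 b1 a2 b2 c)^[n + 1] x0 = hm a1 b1 a2 b2 c ((hm a1 b1 a2 b2 c)^[n] x0) :=
    fun n => Function.iterate_succ_apply' _ _ _
  obtain ⟨k, hk⟩ := eventually_two h (fun n => (hm a1 b1 a2 b2 c)^[n] x0) hx (orb_mem h)
  have ha1 : a1 ≠ 0 := by
    rcases h.2.2.2.2.2.2.2.2.2.2.1 with h | h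
    · exact h.ne
    · exact h.ne'
  obtain ⟨n, q, hc⟩ := complete_two (t := t) (b1 := b1) (b2 := b2) (c := c) ha1 h.2.2.1.ne
    (fun n => (hm a1 b1 a2 b2 c)^[k + n] x0) (fun n => hx (k + n)) (fun n => orb_mem h _)
    (fun n => hk (k + n) (by omega)) (fun n => hne _)
  exact ⟨k + n, q, hc⟩

end complete


section comput
variable {α : Type*} [Primcodable α]

theorem c_br {a1 b1 a2 b2 c y q : α → ℚ} (h1 : Computable a1) (h2 : Computable b1)
    (h3 : Computable a2) (h4 : Computable b2) (h5 : Computable c) (hy : Computable y)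
    (hq : Computable q) :
    Computable (fun a => br (a1 a) (b1 a) (a2 a) (b2 a) (c a) (y a) (q a)) :=
  c_ite (c_qlt hy h5) (c_qadd (c_qmul h1 hq) h2) (c_qadd (c_qmul h3 hq) h4)

theorem c_TT {a1 b1 a2 b2 c : α → ℚ} {z : α → ℚ × ℚ} (h1 : Computable a1) (h2 : Computable b1)
    (h3 : Computable a2) (h4 : Computable b2) (h5 : Computable c) (hz : Computable z) :
    Computable (fun a => TT (a1 a) (b1 a) (a2 a) (b2 a) (c a) (z a)) :=
  Computable.pair (c_br h1 h2 h3 h4 h5 (c_fst hz) (c_fst hz))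
    (c_br h1 h2 h3 h4 h5 (c_fst hz) (c_snd hz))

theorem c_stp {c t : α → ℚ} {z : α → ℚ × ℚ} (h1 : Computable c) (h2 : Computable t)
    (hz : Computable z) : Computable (fun a => stp (c a) (t a) (z a)) :=
  c_and (c_or (c_and (c_qlt (c_fst hz) h1) (c_qle (c_snd hz) h1))
      (c_and (c_qle h1 (c_fst hz)) (c_qle h1 (c_snd hz))))
    (c_or (c_and (c_qlt h2 (c_fst hz)) (c_qle h2 (c_snd hz)))
      (c_and (c_qlt (c_fst hz) h2) (c_qle (c_snd hz) h2)))

theorem c_fin4 {z w : α → ℚ × ℚ} (hz : Computable z) (hw : Computable w) :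
    Computable (fun a => fin4 (z a) (w a)) :=
  c_and (c_qeq (c_snd hw) (c_snd hz))
    (c_or (c_and (c_qlt (c_snd hz) (c_fst hw)) (c_qle (c_fst hw) (c_fst hz)))
      (c_or (c_and (c_qle (c_fst hz) (c_fst hw)) (c_qlt (c_fst hw) (c_snd hz)))
        (c_and (c_qeq (c_fst hz) (c_snd hz)) (c_qeq (c_fst hw) (c_snd hz)))))

theorem c_cert {a1 b1 a2 b2 c t : α → ℚ} {z : α → ℚ × ℚ} (h1 : Computable a1) (h2 : Computable b1)
    (h3 : Computable a2) (h4 : Computable b2) (h5 : Computable c) (h6 : Computable t)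
    (hz : Computable z) :
    Computable (fun a => cert (a1 a) (b1 a) (a2 a) (b2 a) (c a) (t a) (z a)) := by
  have z1 := c_TT h1 h2 h3 h4 h5 hz
  have z2 := c_TT h1 h2 h3 h4 h5 z1
  have z3 := c_TT h1 h2 h3 h4 h5 z2
  have z4 := c_TT h1 h2 h3 h4 h5 z3
  exact c_and (c_stp h5 h6 hz) (c_and (c_stp h5 h6 z1) (c_and (c_stp h5 h6 z2)
    (c_and (c_stp h5 h6 z3) (c_fin4 hz z4))))

theorem c_orb {a1 b1 a2 b2 c x : α → ℚ} {k : α → ℕ} (h1 : Computable a1) (h2 : Computable b1)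
    (h3 : Computable a2) (h4 : Computable b2) (h5 : Computable c) (hx : Computable x)
    (hk : Computable k) :
    Computable (fun a => (hm (a1 a) (b1 a) (a2 a) (b2 a) (c a))^[k a] (x a)) := by
  have hs : Computable₂ (fun (a : α) (p : ℕ × ℚ) => hm (a1 a) (b1 a) (a2 a) (b2 a) (c a) p.2) := by
    have hp : Computable (fun y : α × (ℕ × ℚ) => y.2.2) := c_snd Computable.snd
    exact c_br (h1.comp Computable.fst) (h2.comp Computable.fst) (h3.comp Computable.fst)
      (h4.comp Computable.fst) (h5.comp Computable.fst) hp hp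
  refine (Computable.nat_rec hk hx hs).of_eq fun a => ?_
  induction k a with
  | zero => rfl
  | succ n ih => rw [Function.iterate_succ_apply', ← ih]

open Classical in
theorem c_okP {a1 b1 a2 b2 c x : α → ℚ} (h1 : Computable a1) (h2 : Computable b1)
    (h3 : Computable a2) (h4 : Computable b2) (h5 : Computable c) (hx : Computable x) :
    Computable (fun a => decide (okP (a1 a) (b1 a) (a2 a) (b2 a) (c a) (x a))) := by
  have k0 : Computable (fun _ : α => (0 : ℚ)) := Computable.const 0
  have k1 : Computable (fun _ : α => (1 : ℚ)) := Computable.const 1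
  have he := c_qadd (c_qmul h3 h5) h4
  have hl := c_qadd (c_qmul h1 h5) h2
  refine (c_and (c_qlt k0 h5) (c_and (c_qlt h5 k1) (c_and (c_qlt h3 k0)
    (c_and (c_qle k0 (c_qadd h3 h4)) (c_and (c_qlt he k1) (c_and (c_qle h5 he)
    (c_and (c_qlt he h2) (c_and (c_qle he hl) (c_and (c_qlt h2 k1) (c_and (c_qle hl k1)
    (c_and (c_or (c_qlt h1 k0) (c_qlt k0 h1)) (c_and (c_qle k0 hx) (c_qlt hx k1))))))))))))).of_eq
    fun a => ?_
  rw [Bool.eq_iff_iff, decide_eq_true_iff]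
  simp only [okP, Bool.and_eq_true, Bool.or_eq_true, decide_eq_true_iff]

end comput

theorem okP_of {a1 b1 a2 b2 c x0 : ℚ} (h0 : 0 < c) (h1 : c < 1)
    (hmaps : ∀ x ∈ Set.Ico (0 : ℚ) 1, pam2 a1 b1 a2 b2 c x ∈ Set.Ico (0 : ℚ) 1)
    (hinj : Set.InjOn (pam2 a1 b1 a2 b2 c) (Set.Ico (0 : ℚ) 1))
    (htw : ∀ x ∈ Set.Ico c 1, ∀ y ∈ Set.Ico (0 : ℚ) c,
          pam2 a1 b1 a2 b2 c x < pam2 a1 b1 a2 b2 c y)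
    (ha : a2 < 0) (hc2 : c ≤ a2 * c + b2) (hx : x0 ∈ Set.Ico (0 : ℚ) 1) :
    okP a1 b1 a2 b2 c x0 := by
  have eL : ∀ x, 0 ≤ x → x < c → pam2 a1 b1 a2 b2 c x = a1 * x + b1 := fun x h h' => by
    simp [pam2, h, h']
  have eR : ∀ x, c ≤ x → x < 1 → pam2 a1 b1 a2 b2 c x = a2 * x + b2 := fun x h h' => by
    simp [pam2, h, h', not_lt.2 h]
  have mL : ∀ x, 0 ≤ x → x < c → a1 * x + b1 < 1 := fun x h h' => by
    rw [← eL x h h']; exact (hmaps x ⟨h, by linarith⟩).2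
  have gL : ∀ x, 0 ≤ x → x < c → a2 * c + b2 < a1 * x + b1 := fun x h h' => by
    rw [← eL x h h', ← eR c le_rfl h1]
    exact htw c ⟨le_rfl, h1⟩ x ⟨h, h'⟩
  have mR : ∀ x, c ≤ x → x < 1 → 0 ≤ a2 * x + b2 ∧ a2 * x + b2 < 1 := fun x h h' => by
    rw [← eR x h h']; exact hmaps x ⟨by linarith, h'⟩
  have mb : b1 < 1 := by simpa using mL 0 le_rfl h0
  have gb : a2 * c + b2 < b1 := by simpa using gL 0 le_rfl h0
  refine ⟨h0, h1, ha, ?_, (mR c le_rfl h1).2, hc2, gb, ?_, mb, ?_, ?_, hx.1, hx.2⟩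
  · by_contra hn
    push Not at hn
    have i1 : c ≤ ((a2 + b2) / 2 - b2) / a2 := by
      rw [le_div_iff_of_neg ha]; linarith
    have i2 : ((a2 + b2) / 2 - b2) / a2 < 1 := by
      rw [div_lt_iff_of_neg ha]; linarith
    have := (mR _ i1 i2).1
    rw [mul_div_cancel₀ _ ha.ne] at this
    linarith
  · by_contra hn
    push Not at hn
    have ha1 : a1 < 0 := by
      by_contra h; push Not at h
      have := mul_nonneg h h0.le
      linarith
    have i1 : 0 ≤ (a2 * c + b2 - b1) / a1 := by
      rw [le_div_iff_of_neg ha1]; linarith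
    have i2 : (a2 * c + b2 - b1) / a1 < c := by
      rw [div_lt_iff_of_neg ha1]; linarith
    have := gL _ i1 i2
    rw [mul_div_cancel₀ _ ha1.ne] at this
    linarith
  · by_contra hn
    push Not at hn
    have ha1 : 0 < a1 := by
      by_contra h; push Not at h
      have := mul_nonpos_of_nonpos_of_nonneg h h0.le
      linarith
    have i1 : 0 ≤ (1 - b1) / a1 := div_nonneg (by linarith) ha1.le
    have i2 : (1 - b1) / a1 < c := by
      rw [div_lt_iff₀ ha1]; linarith
    have := mL _ i1 i2
    rw [mul_div_cancel₀ _ ha1.ne'] at this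
    linarith
  · rw [← ne_iff_lt_or_gt]
    rintro rfl
    have := hinj (show (0 : ℚ) ∈ Set.Ico (0 : ℚ) 1 from ⟨le_rfl, by norm_num⟩)
      (show c / 2 ∈ Set.Ico (0 : ℚ) 1 from ⟨by linarith, by linarith⟩)
      (by rw [eL 0 le_rfl h0, eL (c / 2) (by linarith) (by linarith)]; ring)
    linarith

theorem hm_eq_pam {a1 b1 a2 b2 c x0 : ℚ} (h : okP a1 b1 a2 b2 c x0) (n : ℕ) :
    (pam2 a1 b1 a2 b2 c)^[n] x0 = (hm a1 b1 a2 b2 c)^[n] x0 := by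
  induction n with
  | zero => rfl
  | succ n ih =>
    rw [Function.iterate_succ_apply', Function.iterate_succ_apply', ih]
    obtain ⟨i1, i2⟩ := orb_mem h n
    generalize (hm a1 b1 a2 b2 c)^[n] x0 = y at i1 i2
    rcases lt_or_ge y c with hy | hy
    · simp [pam2, hm, br, i1, hy]
    · simp [pam2, hm, br, i2, hy, not_lt.2 hy]

open Classical in
theorem main_aux : ∃ F : ℚ × ℚ × ℚ × ℚ × ℚ × ℚ × ℚ → Bool, Computable F ∧
    ∀ a1 b1 a2 b2 c x0 t : ℚ, okP a1 b1 a2 b2 c x0 →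
      (F (a1, b1, a2, b2, c, x0, t) = true ↔ ∃ n : ℕ, (hm a1 b1 a2 b2 c)^[n] x0 = t) := by
  let hit : ℚ × ℚ × ℚ × ℚ × ℚ × ℚ × ℚ → ℕ → Bool := fun p n => decide
    ((hm p.1 p.2.1 p.2.2.1 p.2.2.2.1 p.2.2.2.2.1)^[n] p.2.2.2.2.2.1 = p.2.2.2.2.2.2)
  let dn : ℚ × ℚ × ℚ × ℚ × ℚ × ℚ × ℚ → ℕ → Bool := fun p k =>
    (! decide (okP p.1 p.2.1 p.2.2.1 p.2.2.2.1 p.2.2.2.2.1 p.2.2.2.2.2.1)) ||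
    (hit p k.unpair.1 || cert p.1 p.2.1 p.2.2.1 p.2.2.2.1 p.2.2.2.2.1 p.2.2.2.2.2.2
      ((hm p.1 p.2.1 p.2.2.1 p.2.2.2.1 p.2.2.2.2.1)^[k.unpair.1] p.2.2.2.2.2.1,
        Denumerable.ofNat ℚ k.unpair.2))
  have hhit : Computable₂ hit := by
    have h : Computable (fun y : (ℚ × ℚ × ℚ × ℚ × ℚ × ℚ × ℚ) × ℕ => y.1) := Computable.fst
    exact c_qeq (c_orb (c_fst h) (c_fst (c_snd h)) (c_fst (c_snd (c_snd h)))
      (c_fst (c_snd (c_snd (c_snd h)))) (c_fst (c_snd (c_snd (c_snd (c_snd h)))))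
      (c_fst (c_snd (c_snd (c_snd (c_snd (c_snd h)))))) Computable.snd)
      (c_snd (c_snd (c_snd (c_snd (c_snd (c_snd h))))))
  have hdn : Computable₂ dn := by
    have h : Computable (fun y : (ℚ × ℚ × ℚ × ℚ × ℚ × ℚ × ℚ) × ℕ => y.1) := Computable.fst
    have g1 := c_fst h
    have g2 := c_fst (c_snd h)
    have g3 := c_fst (c_snd (c_snd h))
    have g4 := c_fst (c_snd (c_snd (c_snd h)))
    have g5 := c_fst (c_snd (c_snd (c_snd (c_snd h))))
    have g6 := c_fst (c_snd (c_snd (c_snd (c_snd (c_snd h)))))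
    have g7 := c_snd (c_snd (c_snd (c_snd (c_snd (c_snd h)))))
    have u1 : Computable (fun y : (ℚ × ℚ × ℚ × ℚ × ℚ × ℚ × ℚ) × ℕ => y.2.unpair.1) :=
      prim_u1.to_comp.comp Computable.snd
    have u2 : Computable (fun y : (ℚ × ℚ × ℚ × ℚ × ℚ × ℚ × ℚ) × ℕ => y.2.unpair.2) :=
      prim_u2.to_comp.comp Computable.snd
    exact c_or (c_not (c_okP g1 g2 g3 g4 g5 g6)) (c_or (hhit.comp h u1)
      (c_cert g1 g2 g3 g4 g5 g7 (Computable.pair (c_orb g1 g2 g3 g4 g5 g6 u1)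
        ((Primrec.ofNat ℚ).to_comp.comp u2))))
  have hex : ∀ p, ∃ k, dn p k = true := by
    intro p
    by_cases hok : okP p.1 p.2.1 p.2.2.1 p.2.2.2.1 p.2.2.2.2.1 p.2.2.2.2.2.1
    · by_cases hh : ∃ n, hit p n = true
      · obtain ⟨n, hn⟩ := hh
        refine ⟨Nat.pair n 0, ?_⟩
        simp only [dn, Nat.unpair_pair, hn, Bool.true_or, Bool.or_true]
      · push Not at hh
        obtain ⟨n, q, hc⟩ := cert_complete (t := p.2.2.2.2.2.2) hok (fun n => by
          have := hh n
          simpa only [hit, ne_eq, decide_eq_true_iff] using this)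
        refine ⟨Nat.pair n (@encode ℚ Primcodable.toEncodable q), ?_⟩
        have e : Denumerable.ofNat ℚ (@encode ℚ Primcodable.toEncodable q) = q :=
          Denumerable.ofNat_encode q
        simp only [dn, Nat.unpair_pair, e, hc, Bool.or_true]
    · exact ⟨0, by simp only [dn, hok, decide_false, Bool.not_false, Bool.true_or]⟩
  refine ⟨fun p => hit p (Nat.find (hex p)).unpair.1,
    hhit.comp Computable.id (prim_u1.to_comp.comp (cfind hdn hex)), ?_⟩
  intro a1 b1 a2 b2 c x0 t hok
  set p : ℚ × ℚ × ℚ × ℚ × ℚ × ℚ × ℚ := (a1, b1, a2, b2, c, x0, t) with hp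
  set K := Nat.find (hex p) with hK
  have hitp : ∀ n, hit p n = true ↔ (hm a1 b1 a2 b2 c)^[n] x0 = t := fun n => by
    simp only [hit, decide_eq_true_iff, hp]
  constructor
  · intro h
    exact ⟨_, (hitp _).1 h⟩
  · rintro ⟨n, hn⟩
    by_contra hF
    have hF : ¬ hit p K.unpair.1 = true := hF
    have hs : dn p K = true := Nat.find_spec (hex p)
    have hcert : cert a1 b1 a2 b2 c t ((hm a1 b1 a2 b2 c)^[K.unpair.1] x0,
        Denumerable.ofNat ℚ K.unpair.2) = true := by
      have hs' : _ := hs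
      simp only [dn, Bool.or_eq_true, Bool.not_eq_true', decide_eq_false_iff_not] at hs'
      rcases hs' with h | h | h
      · exact absurd hok h
      · exact absurd h hF
      · exact h
    rcases lt_or_ge n K.unpair.1 with hlt | hge
    · have h1 : Nat.pair n K.unpair.2 < K := by
        conv_rhs => rw [← Nat.pair_unpair K]
        exact Nat.pair_lt_pair_left _ hlt
      refine Nat.find_min (hex p) h1 ?_
      have := (hitp n).2 hn
      simp only [dn, Nat.unpair_pair, this, Bool.true_or, Bool.or_true]
    · obtain ⟨m, rfl⟩ := Nat.exists_eq_add_of_le hge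
      refine cert_sound hcert m ((hm a1 b1 a2 b2 c)^[K.unpair.1] x0)
        ⟨1, one_pos, le_rfl, by dsimp only; ring⟩ ?_
      rw [← Function.iterate_add_apply, add_comm]
      exact hn

/-- Reachability is decidable for injective two-interval PAM satisfying the twist
condition with `a2 < 0` and cutpoint `c ∈ f([c,1))`. -/
theorem pam_reachability_decidable_neg_slope_cut_in_f2 :
    ∃ F : ℚ × ℚ × ℚ × ℚ × ℚ × ℚ × ℚ → Bool, Computable F ∧
      ∀ a1 b1 a2 b2 c x0 t : ℚ,
        0 < c → c < 1 →
        (∀ x ∈ Set.Ico (0 : ℚ) 1, pam2 a1 b1 a2 b2 c x ∈ Set.Ico (0 : ℚ) 1) →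
        Set.InjOn (pam2 a1 b1 a2 b2 c) (Set.Ico (0 : ℚ) 1) →
        (∀ x ∈ Set.Ico c 1, ∀ y ∈ Set.Ico (0 : ℚ) c,
          pam2 a1 b1 a2 b2 c x < pam2 a1 b1 a2 b2 c y) →
        a2 < 0 →
        a2 + b2 < c → c ≤ a2 * c + b2 →
        x0 ∈ Set.Ico (0 : ℚ) 1 → t ∈ Set.Ico (0 : ℚ) 1 →
        (F (a1, b1, a2, b2, c, x0, t) = true ↔
          ∃ n : ℕ, (pam2 a1 b1 a2 b2 c)^[n] x0 = t) := by
  obtain ⟨F, hF, hF2⟩ := main_aux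
  refine ⟨F, hF, ?_⟩
  intro a1 b1 a2 b2 c x0 t h0 h1 hmaps hinj htw ha _ hc2 hx _
  have hok := okP_of h0 h1 hmaps hinj htw ha hc2 hx
  rw [hF2 a1 b1 a2 b2 c x0 t hok]
  simp only [hm_eq_pam hok]
end

section
/- There is a computable function F : ℚ × ℚ × ℚ × ℚ × ℚ × ℚ × ℚ → Bool such that for all rationals a1, b1, a2, b2, c, x0, t: if the two-interval PAM f defined by these parameters maps [0,1) ∩ ℚ into [0,1) ∩ ℚ, is injective on [0,1) ∩ ℚ, satisfies the twist condition, a2 < 0 < a1, the cutpoint satisfies b1 ≤ c < a1*c + b1 (i.e. c lies in f([0,c))), and x0, t ∈ [0,1) ∩ ℚ, then F (a1, b1, a2, b2, c, x0, t) = true if and only if there exists n : ℕ with f^[n] x0 = t. -/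
namespace PamAux

/-- Decidable form of the hypotheses on the parameters. -/
structure Good (a1 b1 a2 b2 c : ℚ) : Prop where
  c0 : 0 < c
  c1 : c < 1
  a2n : a2 < 0
  a1p : 0 < a1
  b1c : b1 ≤ c
  cL : c < a1 * c + b1
  L1 : a1 * c + b1 ≤ 1
  g0 : 0 ≤ a2 + b2
  gb : a2 * c + b2 < b1

/-- The certificate that the orbit `z` never hits `t` from time `m` on. -/
def Cert (c t : ℚ) (z : ℕ → ℚ) (m k : ℕ) : Prop :=
  ((z m ≤ z (m + k + k) ∧ z (m + k + k) ≤ z (m + k)) ∨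
    (z (m + k) ≤ z (m + k + k) ∧ z (m + k + k) ≤ z m)) ∧
  ∀ j < k, ((z (m + j) < c ∧ z (m + j + k) < c) ∨ (c ≤ z (m + j) ∧ c ≤ z (m + j + k))) ∧
    ((z (m + j) < t ∧ z (m + j + k) < t) ∨ (t < z (m + j) ∧ t < z (m + j + k)))

section
variable {a1 b1 a2 b2 c : ℚ}

lemma f_left {x : ℚ} (h0 : 0 ≤ x) (h1 : x < c) : pam2 a1 b1 a2 b2 c x = a1 * x + b1 := by
  simp [pam2, h0, h1]

lemma f_right {x : ℚ} (h0 : c ≤ x) (h1 : x < 1) : pam2 a1 b1 a2 b2 c x = a2 * x + b2 := by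
  simp [pam2, h0, h1, not_lt.mpr h0]

lemma Good.b1p (h : Good a1 b1 a2 b2 c) : 0 < b1 := by
  have := h.g0; have := h.gb; have := h.a2n; have := h.c1
  nlinarith

lemma Good.f_right_mem (h : Good a1 b1 a2 b2 c) {x : ℚ} (h0 : c ≤ x) (h1 : x < 1) :
    0 ≤ pam2 a1 b1 a2 b2 c x ∧ pam2 a1 b1 a2 b2 c x < b1 := by
  rw [f_right h0 h1]
  have := h.g0; have := h.gb; have := h.a2n
  constructor <;> nlinarith

lemma Good.f_left_mem (h : Good a1 b1 a2 b2 c) {x : ℚ} (h0 : 0 ≤ x) (h1 : x < c) :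
    b1 ≤ pam2 a1 b1 a2 b2 c x ∧ pam2 a1 b1 a2 b2 c x < 1 := by
  rw [f_left h0 h1]
  have := h.L1; have := h.a1p
  constructor <;> nlinarith

lemma Good.mapsTo (h : Good a1 b1 a2 b2 c) :
    Set.MapsTo (pam2 a1 b1 a2 b2 c) (Set.Ico 0 1) (Set.Ico 0 1) := by
  intro x hx
  rcases lt_or_ge x c with h1 | h1
  · have := h.f_left_mem hx.1 h1
    exact ⟨h.b1p.le.trans this.1, this.2⟩
  · have := h.f_right_mem h1 hx.2
    exact ⟨this.1, this.2.trans_le (h.b1c.trans h.c1.le)⟩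

lemma Good.injOn (h : Good a1 b1 a2 b2 c) :
    Set.InjOn (pam2 a1 b1 a2 b2 c) (Set.Ico 0 1) := by
  intro x hx y hy hxy
  rcases lt_or_ge x c with h1 | h1 <;> rcases lt_or_ge y c with h2 | h2
  · rw [f_left hx.1 h1, f_left hy.1 h2] at hxy
    have := h.a1p.ne'
    simpa [this] using hxy
  · have := h.f_left_mem hx.1 h1
    have := h.f_right_mem h2 hy.2
    linarith
  · have := h.f_left_mem hy.1 h2
    have := h.f_right_mem h1 hx.2
    linarith
  · rw [f_right h1 hx.2, f_right h2 hy.2] at hxy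
    have := h.a2n.ne
    simpa [this] using hxy

lemma Good.iter_mem (h : Good a1 b1 a2 b2 c) {x : ℚ} (hx : x ∈ Set.Ico (0 : ℚ) 1) (n : ℕ) :
    (pam2 a1 b1 a2 b2 c)^[n] x ∈ Set.Ico (0 : ℚ) 1 := h.mapsTo.iterate n hx

lemma Good.iter_inj (h : Good a1 b1 a2 b2 c) {x y : ℚ} (hx : x ∈ Set.Ico (0 : ℚ) 1)
    (hy : y ∈ Set.Ico (0 : ℚ) 1) (n : ℕ)
    (he : (pam2 a1 b1 a2 b2 c)^[n] x = (pam2 a1 b1 a2 b2 c)^[n] y) : x = y :=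
  (h.injOn.iterate h.mapsTo n) hx hy he

/-- If `t` is periodic, hits happen early. -/
lemma Good.sound_t (h : Good a1 b1 a2 b2 c) {x t : ℚ} (hx : x ∈ Set.Ico (0 : ℚ) 1)
    (ht : t ∈ Set.Ico (0 : ℚ) 1) {k : ℕ} (hk : 0 < k) (hp : (pam2 a1 b1 a2 b2 c)^[k] t = t)
    {n : ℕ} (hn : (pam2 a1 b1 a2 b2 c)^[n] x = t) :
    ∃ i < k, (pam2 a1 b1 a2 b2 c)^[i] x = t := by
  refine ⟨n % k, Nat.mod_lt _ hk, ?_⟩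
  apply h.iter_inj (h.iter_mem hx _) ht (k * (n / k))
  rw [← Function.iterate_add_apply, Nat.div_add_mod, hn, Function.iterate_mul]
  exact (Function.iterate_fixed hp _).symm

lemma sound_x {f : ℚ → ℚ} {x t : ℚ} {k : ℕ} (hk : 0 < k) (hp : f^[k] x = x)
    {n : ℕ} (hn : f^[n] x = t) : ∃ i < k, f^[i] x = t := by
  refine ⟨n % k, Nat.mod_lt _ hk, ?_⟩
  rw [← hn]
  conv_rhs => rw [← Nat.mod_add_div n k, Function.iterate_add_apply, Function.iterate_mul,
    Function.iterate_fixed hp]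

lemma Good.uIcc_step (h : Good a1 b1 a2 b2 c) {u v x : ℚ} (hu : u ∈ Set.Ico (0 : ℚ) 1)
    (hv : v ∈ Set.Ico (0 : ℚ) 1) (hs : (u < c ∧ v < c) ∨ (c ≤ u ∧ c ≤ v))
    (hx : (u ≤ x ∧ x ≤ v) ∨ (v ≤ x ∧ x ≤ u)) :
    (pam2 a1 b1 a2 b2 c u ≤ pam2 a1 b1 a2 b2 c x ∧
      pam2 a1 b1 a2 b2 c x ≤ pam2 a1 b1 a2 b2 c v) ∨
    (pam2 a1 b1 a2 b2 c v ≤ pam2 a1 b1 a2 b2 c x ∧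
      pam2 a1 b1 a2 b2 c x ≤ pam2 a1 b1 a2 b2 c u) := by
  have ha1 := h.a1p
  have ha2 := h.a2n
  obtain ⟨hu0, hu1⟩ := hu
  obtain ⟨hv0, hv1⟩ := hv
  rcases hs with ⟨h1, h2⟩ | ⟨h1, h2⟩
  · have hx0 : 0 ≤ x := by rcases hx with hx | hx <;> linarith
    have hx1 : x < c := by rcases hx with hx | hx <;> linarith
    rw [f_left hu0 h1, f_left hv0 h2, f_left hx0 hx1]
    rcases hx with hx | hx
    · left; constructor <;> nlinarith
    · right; constructor <;> nlinarith
  · have hx0 : c ≤ x := by rcases hx with hx | hx <;> linarith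
    have hx1 : x < 1 := by rcases hx with hx | hx <;> linarith
    rw [f_right h1 hu1, f_right h2 hv1, f_right hx0 hx1]
    rcases hx with hx | hx
    · right; constructor <;> nlinarith
    · left; constructor <;> nlinarith

lemma Good.sound_cert (h : Good a1 b1 a2 b2 c) {x t : ℚ} (hx : x ∈ Set.Ico (0 : ℚ) 1)
    {m k : ℕ} (hk : 0 < k)
    (hc : Cert c t (fun n => (pam2 a1 b1 a2 b2 c)^[n] x) m k)
    {n : ℕ} (hn : (pam2 a1 b1 a2 b2 c)^[n] x = t) : n < m := by
  obtain ⟨hc1, hc2⟩ := hc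
  set f := pam2 a1 b1 a2 b2 c with hf
  by_contra hnm
  push Not at hnm
  -- hull propagation
  have key : ∀ w, ((f^[m] x ≤ w ∧ w ≤ f^[m + k] x) ∨ (f^[m + k] x ≤ w ∧ w ≤ f^[m] x)) →
      ∀ j ≤ k, ((f^[m + j] x ≤ f^[j] w ∧ f^[j] w ≤ f^[m + j + k] x) ∨
        (f^[m + j + k] x ≤ f^[j] w ∧ f^[j] w ≤ f^[m + j] x)) := by
    intro w hw j
    induction j with
    | zero => intro _; simpa using hw
    | succ j ih =>
      intro hj
      have h1 := ih (by omega)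
      have h2 := h.uIcc_step (h.iter_mem hx (m + j)) (h.iter_mem hx (m + j + k))
        (hc2 j (by omega)).1 h1
      have e1 : m + (j + 1) = (m + j) + 1 := by ring
      have e2 : m + (j + 1) + k = (m + j + k) + 1 := by ring
      rw [e2, e1, Function.iterate_succ_apply', Function.iterate_succ_apply',
        Function.iterate_succ_apply']
      exact h2
  have key2 : ∀ q, ((f^[m] x ≤ f^[m + k * q] x ∧ f^[m + k * q] x ≤ f^[m + k] x) ∨
      (f^[m + k] x ≤ f^[m + k * q] x ∧ f^[m + k * q] x ≤ f^[m] x)) := by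
    intro q
    induction q with
    | zero => rcases le_total (f^[m] x) (f^[m + k] x) with h | h <;> simp [h]
    | succ q ih =>
      have h1 := key _ ih k le_rfl
      have e : m + k * (q + 1) = k + (m + k * q) := by ring
      rw [e, Function.iterate_add_apply f k]
      simp only at hc1
      rcases hc1 with hc1 | hc1 <;> rcases h1 with h1 | h1
      · left; constructor <;> linarith
      · left; constructor <;> linarith
      · right; constructor <;> linarith
      · right; constructor <;> linarith
  have h3 := key _ (key2 ((n - m) / k)) ((n - m) % k) (Nat.mod_lt _ hk).le
  have h4 := (hc2 ((n - m) % k) (Nat.mod_lt _ hk)).2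
  rw [← Function.iterate_add_apply] at h3
  have e : (n - m) % k + (m + k * ((n - m) / k)) = n := by
    have := Nat.mod_add_div (n - m) k
    omega
  rw [e, hn] at h3
  simp only at h4
  rcases h3 with h3 | h3 <;> rcases h4 with h4 | h4 <;> linarith

/-- The left branch. -/
def L (a1 b1 : ℚ) (x : ℚ) : ℚ := a1 * x + b1

lemma L_iter (a1 b1 x : ℚ) (n : ℕ) : (L a1 b1)^[n] x = a1 ^ n * x + (L a1 b1)^[n] 0 := by
  induction n with
  | zero => simp
  | succ n ih =>
    rw [Function.iterate_succ_apply', Function.iterate_succ_apply', ih]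
    simp only [L]; ring

lemma L_lt (ha : 0 < a1) {x y : ℚ} (hxy : x < y) (n : ℕ) :
    (L a1 b1)^[n] x < (L a1 b1)^[n] y := by
  rw [L_iter a1 b1 x, L_iter a1 b1 y]
  have := mul_lt_mul_of_pos_left hxy (pow_pos ha n)
  linarith

lemma L_le (ha : 0 < a1) {x y : ℚ} (hxy : x ≤ y) (n : ℕ) :
    (L a1 b1)^[n] x ≤ (L a1 b1)^[n] y := by
  rw [L_iter a1 b1 x, L_iter a1 b1 y]
  have := mul_le_mul_of_nonneg_left hxy (pow_pos ha n).le
  linarith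

lemma Good.L_nonneg (h : Good a1 b1 a2 b2 c) {x : ℚ} (hx : 0 ≤ x) (n : ℕ) :
    0 ≤ (L a1 b1)^[n] x := by
  induction n with
  | zero => simpa
  | succ n ih =>
    rw [Function.iterate_succ_apply', L]
    have := h.b1p; have := h.a1p
    positivity

lemma Good.exists_N (h : Good a1 b1 a2 b2 c) : ∃ n, c ≤ (L a1 b1)^[n] 0 := by
  by_contra hcon
  push Not at hcon
  obtain ⟨δ, hδ, h1, h2⟩ : ∃ δ : ℚ, 0 < δ ∧ δ ≤ b1 ∧ δ ≤ a1 * c + b1 - c :=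
    ⟨min b1 (a1 * c + b1 - c), lt_min h.b1p (by linarith [h.cL]), min_le_left _ _,
      min_le_right _ _⟩
  have key : ∀ n : ℕ, n * δ ≤ (L a1 b1)^[n] 0 := by
    intro n
    induction n with
    | zero => simp
    | succ n ih =>
      rw [Function.iterate_succ_apply']
      have hlt := hcon n
      have h0 := h.L_nonneg le_rfl n
      set y := (L a1 b1)^[n] 0
      have : c * (y + δ) ≤ c * L a1 b1 y := by
        simp only [L]
        nlinarith [mul_nonneg (sub_nonneg.2 h1) (sub_nonneg.2 hlt.le),
          mul_nonneg h0 (sub_nonneg.2 h2)]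
      have := le_of_mul_le_mul_left this h.c0
      push_cast
      linarith
  obtain ⟨n, hn⟩ := exists_nat_gt (c / δ)
  rw [div_lt_iff₀ hδ] at hn
  linarith [key n, hcon n]

/-- Points that take `r` left steps and then a right step. -/
def X (a1 b1 c : ℚ) (r : ℕ) (x : ℚ) : Prop :=
  (∀ i < r, 0 ≤ (L a1 b1)^[i] x ∧ (L a1 b1)^[i] x < c) ∧
    c ≤ (L a1 b1)^[r] x ∧ (L a1 b1)^[r] x < 1

lemma X_iter {r : ℕ} {x : ℚ} (hx : X a1 b1 c r x) : ∀ j ≤ r,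
    (pam2 a1 b1 a2 b2 c)^[j] x = (L a1 b1)^[j] x := by
  intro j
  induction j with
  | zero => simp
  | succ j ih =>
    intro hj
    have := hx.1 j (by omega)
    rw [Function.iterate_succ_apply', Function.iterate_succ_apply', ih (by omega),
      f_left this.1 this.2, L]

lemma X_iter_last {r : ℕ} {x : ℚ} (hx : X a1 b1 c r x) :
    (pam2 a1 b1 a2 b2 c)^[r + 1] x = a2 * (L a1 b1)^[r] x + b2 := by
  rw [Function.iterate_succ_apply', X_iter hx r le_rfl, f_right hx.2.1 hx.2.2]

lemma X_convex (ha : 0 < a1) {r : ℕ} {u v x : ℚ} (hu : X a1 b1 c r u) (hv : X a1 b1 c r v)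
    (hx : (u ≤ x ∧ x ≤ v) ∨ (v ≤ x ∧ x ≤ u)) : X a1 b1 c r x := by
  wlog hx' : u ≤ x ∧ x ≤ v generalizing u v
  · exact this hv hu hx.symm (by tauto)
  exact ⟨fun i hi => ⟨(hu.1 i hi).1.trans (L_le ha hx'.1 i), (L_le ha hx'.2 i).trans_lt (hv.1 i hi).2⟩,
    hu.2.1.trans (L_le ha hx'.1 r), (L_le ha hx'.2 r).trans_lt hv.2.2⟩

lemma Good.exists_X (h : Good a1 b1 a2 b2 c) {x : ℚ} (hx : x ∈ Set.Ico (0 : ℚ) 1) :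
    ∃ r m, ∀ n, X a1 b1 c r ((pam2 a1 b1 a2 b2 c)^[m + (r + 1) * n] x) := by
  set f := pam2 a1 b1 a2 b2 c with hf
  have ha := h.a1p
  -- the minimal escape time
  obtain ⟨M, hM1, hM2⟩ : ∃ M, (∀ i ≤ M, (L a1 b1)^[i] 0 < c) ∧ c ≤ (L a1 b1)^[M + 1] 0 := by
    classical
    have hN := Nat.find_spec h.exists_N
    have hmin := fun i => Nat.find_min h.exists_N (m := i)
    set N := Nat.find h.exists_N
    obtain _ | M := N
    · exact absurd hN (by simpa using h.c0)
    · exact ⟨M, fun i hi => not_le.1 (hmin i (by omega)), hN⟩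
  have hL0 : L a1 b1 0 = b1 := by simp [L]
  have hsh : ∀ i, (L a1 b1)^[i] b1 = (L a1 b1)^[i + 1] 0 := fun i => by
    rw [Function.iterate_succ_apply, hL0]
  have hLc : ∀ y, y < c → L a1 b1 y < 1 := fun y hy => by
    have := h.L1
    simp only [L]; nlinarith
  have hlow : ∀ y, 0 ≤ y → y < b1 → ∀ i < M, 0 ≤ (L a1 b1)^[i] y ∧ (L a1 b1)^[i] y < c := by
    intro y h0 h1 i hi
    refine ⟨h.L_nonneg h0 i, (L_lt ha h1 i).trans ?_⟩
    rw [hsh]; exact hM1 _ (by omega)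
  have hhi : ∀ y, 0 ≤ y → y < b1 → c ≤ (L a1 b1)^[M] y → X a1 b1 c M y := by
    intro y h0 h1 h2
    refine ⟨hlow y h0 h1, h2, (L_lt ha h1 M).trans ?_⟩
    rw [hsh, Function.iterate_succ_apply']
    exact hLc _ (hM1 M le_rfl)
  have hlo : ∀ y, 0 ≤ y → y < b1 → (L a1 b1)^[M] y < c → X a1 b1 c (M + 1) y := by
    intro y h0 h1 h2
    refine ⟨fun i hi => ?_, hM2.trans (L_le ha h0 _), ?_⟩
    · rcases Nat.lt_succ_iff_lt_or_eq.1 hi with h3 | rfl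
      · exact hlow y h0 h1 i h3
      · exact ⟨h.L_nonneg h0 _, h2⟩
    · rw [Function.iterate_succ_apply']; exact hLc _ h2
  have hret : ∀ r y, X a1 b1 c r y → 0 ≤ f^[r + 1] y ∧ f^[r + 1] y < b1 := by
    intro r y hy
    rw [Function.iterate_succ_apply', X_iter hy r le_rfl]
    exact h.f_right_mem hy.2.1 hy.2.2
  -- the orbit reaches `[0, b1)`
  obtain ⟨m, hm0, hm1⟩ : ∃ m, 0 ≤ f^[m] x ∧ f^[m] x < b1 := by
    obtain ⟨i, hi⟩ : ∃ i, c ≤ f^[i] x := by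
      by_contra hcon
      push Not at hcon
      have e : ∀ i, f^[i] x = (L a1 b1)^[i] x := by
        intro i
        induction i with
        | zero => rfl
        | succ i ih =>
          rw [Function.iterate_succ_apply', Function.iterate_succ_apply', ← ih]
          exact f_left (h.iter_mem hx i).1 (hcon i)
      have := hcon (M + 1)
      rw [e] at this
      have := L_le (b1 := b1) ha hx.1 (M + 1)
      linarith
    refine ⟨i + 1, ?_⟩
    rw [Function.iterate_succ_apply']
    exact h.f_right_mem hi (h.iter_mem hx i).2
  set q := a2 * (L a1 b1)^[M + 1] 0 + b2 with hq
  have hhiq : ∀ y, 0 ≤ y → y < b1 → c ≤ (L a1 b1)^[M] y → q < f^[M + 1] y := by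
    intro y h0 h1 h2
    rw [X_iter_last (hhi y h0 h1 h2), hq]
    have := L_lt (b1 := b1) ha h1 M
    rw [hsh] at this
    nlinarith [h.a2n]
  have hloq : ∀ y, 0 ≤ y → y < b1 → (L a1 b1)^[M] y < c → f^[M + 1 + 1] y ≤ q := by
    intro y h0 h1 h2
    rw [X_iter_last (hlo y h0 h1 h2), hq]
    have := L_le (b1 := b1) ha h0 (M + 1)
    nlinarith [h.a2n]
  have estep : ∀ r m n, f^[m + (r + 1) * (n + 1)] x = f^[r + 1] (f^[m + (r + 1) * n] x) := by
    intro r m n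
    rw [← Function.iterate_add_apply]; congr 1; ring
  -- generic conclusions
  have concl_hi : ∀ m, (∀ n, (0 ≤ f^[m + (M + 1) * n] x ∧ f^[m + (M + 1) * n] x < b1) ∧
      c ≤ (L a1 b1)^[M] (f^[m + (M + 1) * n] x)) →
      ∃ r m, ∀ n, X a1 b1 c r (f^[m + (r + 1) * n] x) := by
    intro m H
    exact ⟨M, m, fun n => hhi _ (H n).1.1 (H n).1.2 (H n).2⟩
  have concl_lo : ∀ m, (∀ n, (0 ≤ f^[m + (M + 1 + 1) * n] x ∧ f^[m + (M + 1 + 1) * n] x < b1) ∧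
      (L a1 b1)^[M] (f^[m + (M + 1 + 1) * n] x) < c) →
      ∃ r m, ∀ n, X a1 b1 c r (f^[m + (r + 1) * n] x) := by
    intro m H
    exact ⟨M + 1, m, fun n => hlo _ (H n).1.1 (H n).1.2 (H n).2⟩
  rcases le_or_gt c ((L a1 b1)^[M] q) with hcq | hcq
  · by_cases hex : ∃ m, (0 ≤ f^[m] x ∧ f^[m] x < b1) ∧ c ≤ (L a1 b1)^[M] (f^[m] x)
    · obtain ⟨m, hm, hmc⟩ := hex
      apply concl_hi m
      intro n
      induction n with
      | zero => exact ⟨by simpa using hm, by simpa using hmc⟩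
      | succ n ih =>
        rw [estep]
        exact ⟨hret _ _ (hhi _ ih.1.1 ih.1.2 ih.2),
          hcq.trans (L_le ha (hhiq _ ih.1.1 ih.1.2 ih.2).le M)⟩
    · push Not at hex
      apply concl_lo m
      intro n
      induction n with
      | zero => exact ⟨by simpa using ⟨hm0, hm1⟩, by simpa using hex m ⟨hm0, hm1⟩⟩
      | succ n ih =>
        have := hret _ _ (hlo _ ih.1.1 ih.1.2 ih.2)
        rw [← estep] at this
        exact ⟨this, hex _ this⟩
  · by_cases hex : ∃ m, (0 ≤ f^[m] x ∧ f^[m] x < b1) ∧ (L a1 b1)^[M] (f^[m] x) < c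
    · obtain ⟨m, hm, hmc⟩ := hex
      apply concl_lo m
      intro n
      induction n with
      | zero => exact ⟨by simpa using hm, by simpa using hmc⟩
      | succ n ih =>
        rw [estep]
        exact ⟨hret _ _ (hlo _ ih.1.1 ih.1.2 ih.2),
          (L_le ha (hloq _ ih.1.1 ih.1.2 ih.2) M).trans_lt hcq⟩
    · push Not at hex
      apply concl_hi m
      intro n
      induction n with
      | zero => exact ⟨by simpa using ⟨hm0, hm1⟩, by simpa using hex m ⟨hm0, hm1⟩⟩
      | succ n ih =>
        have := hret _ _ (hhi _ ih.1.1 ih.1.2 ih.2)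
        rw [← estep] at this
        exact ⟨this, hex _ this⟩

lemma Good.complete (h : Good a1 b1 a2 b2 c) {x t : ℚ} (hx : x ∈ Set.Ico (0 : ℚ) 1) :
    ∃ m k, 0 < k ∧ ((pam2 a1 b1 a2 b2 c)^[k] t = t ∨ (pam2 a1 b1 a2 b2 c)^[k] x = x ∨
      Cert c t (fun n => (pam2 a1 b1 a2 b2 c)^[n] x) m k) := by
  obtain ⟨r, m, hX⟩ := h.exists_X hx
  set f := pam2 a1 b1 a2 b2 c with hf
  have ha := h.a1p
  set β := fun j => (L a1 b1)^[j] 0 with hβ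
  have hL : ∀ j x, (L a1 b1)^[j] x = a1 ^ j * x + β j := fun j x => L_iter a1 b1 x j
  set s := a2 * a1 ^ r with hs
  have hsn : s < 0 := mul_neg_of_neg_of_pos h.a2n (pow_pos ha r)
  set d := a2 * β r + b2 with hd
  set e := d / (1 - s) with he
  have hfix : s * e + d = e := by
    rw [he]; field_simp [show (1 - s) ≠ 0 by linarith]; ring
  set y := fun n => f^[m + (r + 1) * n] x with hy
  have hS : ∀ w, X a1 b1 c r w → f^[r + 1] w = s * w + d := by
    intro w hw
    rw [X_iter_last hw, hL]; ring
  have estep : ∀ n, y (n + 1) = s * y n + d := by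
    intro n
    rw [← hS _ (hX n)]
    simp only [hy]
    rw [← Function.iterate_add_apply]; congr 1; ring
  have estep' : ∀ n, y (n + 1) - e = s * (y n - e) := by
    intro n; rw [estep]; linarith
  have hpow : ∀ n, y n - e = s ^ n * (y 0 - e) := by
    intro n
    induction n with
    | zero => simp
    | succ n ih => rw [estep', ih]; ring
  -- periodic orbit case
  have hper : ∀ n, 0 < n → y n = y 0 → f^[(r + 1) * n] x = x := by
    intro n _ hn0
    apply h.iter_inj (h.iter_mem hx _) hx m
    rw [← Function.iterate_add_apply]
    simpa [hy] using hn0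
  by_cases hy0 : y 0 = e
  · refine ⟨0, (r + 1) * 1, by omega, Or.inr (Or.inl (hper 1 one_pos ?_))⟩
    have := hpow 1
    rw [hy0] at this ⊢
    linarith
  have hyb : ∀ n, 0 ≤ y n ∧ y n < 1 := fun n => h.iter_mem hx _
  have habs : 0 < |y 0 - e| := abs_pos.2 (sub_ne_zero.2 hy0)
  rcases lt_trichotomy |s| 1 with hs1 | hs1 | hs1
  · -- contracting case
    have hbet : ∀ n, (y n ≤ e ∧ e ≤ y (n + 1)) ∨ (y (n + 1) ≤ e ∧ e ≤ y n) := by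
      intro n
      have := estep' n
      rcases le_total (y n) e with h1 | h1
      · left; refine ⟨h1, ?_⟩; nlinarith
      · right; refine ⟨?_, h1⟩; nlinarith
    have hXe : X a1 b1 c r e := X_convex ha (hX 0) (hX 1) (hbet 0)
    have hfe : f^[r + 1] e = e := by rw [hS e hXe, hfix]
    by_cases hte : ∃ j ≤ r, t = (L a1 b1)^[j] e
    · obtain ⟨j, hj, rfl⟩ := hte
      refine ⟨0, r + 1, by omega, Or.inl ?_⟩
      rw [← X_iter (a2 := a2) (b2 := b2) hXe j hj, ← hf, ← Function.iterate_add_apply,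
        add_comm, Function.iterate_add_apply, hfe]
    push Not at hte
    have hsm1 : -1 < s := by rw [abs_lt] at hs1; exact hs1.1
    have hev : ∀ j ∈ Finset.range (r + 1), ∀ᶠ n in Filter.atTop,
        a1 ^ j * (|s| ^ n * |y 0 - e|) < |t - (L a1 b1)^[j] e| := by
      intro j hj
      have htend : Filter.Tendsto (fun n : ℕ => a1 ^ j * (|s| ^ n * |y 0 - e|)) Filter.atTop
          (nhds (a1 ^ j * (0 * |y 0 - e|))) :=
        ((tendsto_pow_atTop_nhds_zero_of_lt_one (abs_nonneg s) hs1).mul_const _).const_mul _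
      apply htend.eventually_lt_const
      simp only [zero_mul, mul_zero]
      exact abs_pos.2 (sub_ne_zero.2 (hte j (by simpa [Nat.lt_succ_iff] using hj)))
    rw [← Filter.eventually_all_finset] at hev
    obtain ⟨n, hn⟩ := hev.exists
    refine ⟨m + (r + 1) * n, r + 1, by omega, Or.inr (Or.inr ?_)⟩
    have e1 : m + (r + 1) * n + (r + 1) = m + (r + 1) * (n + 1) := by ring
    have e2 : m + (r + 1) * (n + 1) + (r + 1) = m + (r + 1) * (n + 1 + 1) := by ring
    have hor' : ∀ n j, j ≤ r → f^[m + (r + 1) * n + j] x = (L a1 b1)^[j] (y n) := by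
      intro n j hj
      rw [add_comm, Function.iterate_add_apply, X_iter (hX n) j hj]
    have hor : ∀ n j, j ≤ r → f^[m + (r + 1) * n + j] x = a1 ^ j * y n + β j := by
      intro n j hj
      rw [hor' n j hj, hL]
    constructor
    · simp only [e1, e2]
      change (y n ≤ y (n + 1 + 1) ∧ y (n + 1 + 1) ≤ y (n + 1)) ∨
        (y (n + 1) ≤ y (n + 1 + 1) ∧ y (n + 1 + 1) ≤ y n)
      have h1 := estep' n
      have h2 := estep' (n + 1)
      rcases hbet n with hb | hb
      · left; constructor <;> nlinarith
      · right; constructor <;> nlinarith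
    · intro j hj
      have hjr : j ≤ r := by omega
      have e3 : m + (r + 1) * n + j + (r + 1) = m + (r + 1) * (n + 1) + j := by ring
      simp only [e3]
      constructor
      · rw [hor' n j hjr, hor' (n + 1) j hjr]
        rcases Nat.lt_or_eq_of_le hjr with h1 | rfl
        · left; exact ⟨((hX n).1 j h1).2, ((hX (n + 1)).1 j h1).2⟩
        · right; exact ⟨(hX n).2.1, (hX (n + 1)).2.1⟩
      · rw [hor n j hjr, hor (n + 1) j hjr]
        have h1 := hn j (by simpa using hj)
        rw [hL] at h1
        have h2 : |y n - e| = |s| ^ n * |y 0 - e| := by rw [hpow n, abs_mul, abs_pow]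
        have h3 : |y (n + 1) - e| ≤ |y n - e| := by
          rw [estep', abs_mul]
          exact mul_le_of_le_one_left (abs_nonneg _) hs1.le
        rw [← h2] at h1
        have hp := pow_pos ha j
        have h4 : a1 ^ j * |y (n + 1) - e| < |t - (a1 ^ j * e + β j)| :=
          (mul_le_mul_of_nonneg_left h3 hp.le).trans_lt h1
        have b1 := le_abs_self (y n - e)
        have b2 := neg_abs_le (y n - e)
        have b3 := le_abs_self (y (n + 1) - e)
        have b4 := neg_abs_le (y (n + 1) - e)
        rcases abs_cases (t - (a1 ^ j * e + β j)) with hh | hh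
        · left; constructor <;> nlinarith
        · right; constructor <;> nlinarith
  · refine ⟨0, (r + 1) * 2, by omega, Or.inr (Or.inl (hper 2 two_pos ?_))⟩
    have hsm : s = -1 := by rw [abs_of_neg hsn] at hs1; linarith
    have := hpow 2
    rw [hsm] at this
    linarith
  · exfalso
    obtain ⟨n, hn⟩ := pow_unbounded_of_one_lt ((1 + |e|) / |y 0 - e|) hs1
    rw [div_lt_iff₀ habs] at hn
    have h2 : |y n - e| = |s| ^ n * |y 0 - e| := by rw [hpow n, abs_mul, abs_pow]
    rw [← h2] at hn
    have h3 : |y n - e| ≤ |y n| + |e| := abs_sub _ _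
    rw [abs_of_nonneg (hyb n).1] at h3
    linarith [(hyb n).2]

end

section Comp
variable {α σ : Type*} [Primcodable α] [Primcodable σ]

/-- Computably decidable predicates. -/
def CP (p : α → Prop) : Prop := ∃ b : α → Bool, Computable b ∧ ∀ a, b a = true ↔ p a

lemma CP.of_iff {p q : α → Prop} (hp : CP p) (h : ∀ a, p a ↔ q a) : CP q := by
  obtain ⟨b, hb, hb'⟩ := hp
  exact ⟨b, hb, fun a => (hb' a).trans (h a)⟩

lemma CP.comp {p : σ → Prop} (hp : CP p) {f : α → σ} (hf : Computable f) :
    CP (fun a => p (f a)) := by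
  obtain ⟨b, hb, hb'⟩ := hp
  exact ⟨fun a => b (f a), hb.comp hf, fun a => hb' _⟩

lemma CP.not {p : α → Prop} (hp : CP p) : CP (fun a => ¬ p a) := by
  obtain ⟨b, hb, hb'⟩ := hp
  exact ⟨fun a => !(b a), Primrec.not.to_comp.comp hb, fun a => by simp [← hb']⟩

lemma CP.and {p q : α → Prop} (hp : CP p) (hq : CP q) : CP (fun a => p a ∧ q a) := by
  obtain ⟨b, hb, hb'⟩ := hp
  obtain ⟨d, hd, hd'⟩ := hq
  exact ⟨fun a => b a && d a, Primrec.and.to_comp.comp hb hd, fun a => by simp [← hb', ← hd']⟩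

lemma CP.or {p q : α → Prop} (hp : CP p) (hq : CP q) : CP (fun a => p a ∨ q a) := by
  obtain ⟨b, hb, hb'⟩ := hp
  obtain ⟨d, hd, hd'⟩ := hq
  exact ⟨fun a => b a || d a, Primrec.or.to_comp.comp hb hd, fun a => by simp [← hb', ← hd']⟩

lemma CP.ball {p : α → ℕ → Prop} (hp : CP (fun x : α × ℕ => p x.1 x.2)) {n : α → ℕ}
    (hn : Computable n) : CP (fun a => ∀ j < n a, p a j) := by
  obtain ⟨b, hb, hb'⟩ := hp
  refine ⟨fun a => Nat.rec true (fun j v => v && b (a, j)) (n a), ?_, fun a => ?_⟩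
  · refine Computable.nat_rec (h := fun a x => x.2 && b (a, x.1)) hn (Computable.const true) ?_
    refine Computable₂.mk ?_
    exact Primrec.and.to_comp.comp (Computable.snd.comp Computable.snd)
      (hb.comp (Computable.pair Computable.fst (Computable.fst.comp Computable.snd)))
  · beta_reduce
    generalize n a = k
    induction k with
    | zero => simp
    | succ k ih =>
      have e : ((Nat.rec true (fun j v => v && b (a, j)) (k + 1) : Bool) = true) ↔
          ((Nat.rec true (fun j v => v && b (a, j)) k : Bool) = true) ∧ b (a, k) = true := by
        simp
      rw [e, ih, hb']
      constructor
      · rintro ⟨h1, h2⟩ j hj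
        rcases Nat.lt_succ_iff_lt_or_eq.1 hj with h | rfl
        · exact h1 j h
        · exact h2
      · intro h
        exact ⟨fun j hj => h j (by omega), h k (by omega)⟩

lemma CP.ite {p : α → Prop} [DecidablePred p] (hp : CP p) {f g : α → σ} (hf : Computable f)
    (hg : Computable g) : Computable (fun a => if p a then f a else g a) := by
  obtain ⟨b, hb, hb'⟩ := hp
  refine (Computable.cond hb hf hg).of_eq fun a => ?_
  by_cases h : p a
  · simp [h, (hb' a).2 h]
  · have : b a = false := by rw [← Bool.not_eq_true, hb']; exact h
    simp [h, this]

lemma CP.find {p : α → ℕ → Prop} (hp : CP (fun x : α × ℕ => p x.1 x.2))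
    (h : ∀ a, ∃ n, p a n) : ∃ g : α → ℕ, Computable g ∧ ∀ a, p a (g a) := by
  obtain ⟨b, hb, hb'⟩ := hp
  have h' : ∀ a, ∃ n, b (a, n) = true := fun a => (h a).imp fun n hn => (hb' (a, n)).2 hn
  have hpr : Partrec fun a => Nat.rfind (fun n => (Part.some (b (a, n)) : Part Bool)) :=
    Partrec.rfind (p := fun a n => Part.some (b (a, n))) hb.partrec.to₂
  refine ⟨fun a => Nat.find (h' a), hpr.of_eq_tot fun a => ?_, fun a =>
    (hb' (a, _)).1 (Nat.find_spec (h' a))⟩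
  refine Nat.mem_rfind.2 ⟨?_, ?_⟩
  · simpa using Nat.find_spec (h' a)
  · intro m hm
    have := Nat.find_min (h' a) hm
    simpa using this

lemma CP.graph {τ : Type*} [Denumerable τ] {f : α → τ}
    (hp : CP (fun x : α × τ => f x.1 = x.2)) : Computable f := by
  obtain ⟨g, hg, hg'⟩ := CP.find (p := fun a n => f a = Denumerable.ofNat τ n)
    (hp.comp (f := fun x : α × ℕ => (x.1, Denumerable.ofNat τ x.2))
      (Computable.pair Computable.fst ((Computable.ofNat τ).comp Computable.snd)))
    (fun a => ⟨Encodable.encode (f a), by simp⟩)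
  exact ((Computable.ofNat τ).comp hg).of_eq fun a => (hg' a).symm

lemma CP.eq {f g : α → σ} (hf : Computable f) (hg : Computable g) : CP (fun a => f a = g a) := by
  classical
  exact ⟨fun a => decide (f a = g a), (Primrec.eq (α := σ)).decide.to_comp.comp hf hg, by simp⟩

lemma CP.nlt {f g : α → ℕ} (hf : Computable f) (hg : Computable g) : CP (fun a => f a < g a) :=
  ⟨fun a => decide (f a < g a), Primrec.nat_lt.decide.to_comp.comp hf hg, by simp⟩

lemma c_nadd {f g : α → ℕ} (hf : Computable f) (hg : Computable g) :
    Computable (fun a => f a + g a) := Primrec.nat_add.to_comp.comp hf hg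

lemma c_nmul {f g : α → ℕ} (hf : Computable f) (hg : Computable g) :
    Computable (fun a => f a * g a) := Primrec.nat_mul.to_comp.comp hf hg

lemma c_ndiv {f g : α → ℕ} (hf : Computable f) (hg : Computable g) :
    Computable (fun a => f a / g a) := Primrec.nat_div.to_comp.comp hf hg

lemma c_nmod {f g : α → ℕ} (hf : Computable f) (hg : Computable g) :
    Computable (fun a => f a % g a) := Primrec.nat_mod.to_comp.comp hf hg

lemma c_unpair1 {f : α → ℕ} (hf : Computable f) : Computable (fun a => (f a).unpair.1) :=
  Computable.fst.comp (Computable.unpair.comp hf)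

lemma c_unpair2 {f : α → ℕ} (hf : Computable f) : Computable (fun a => (f a).unpair.2) :=
  Computable.snd.comp (Computable.unpair.comp hf)

/-- The underlying (non-surjective) encoding of the rationals. -/
def enc0 (q : ℚ) : ℕ := @Encodable.encode ℚ Rat.instEncodable q

lemma enc0_eq (q : ℚ) : enc0 q = Nat.pair (Encodable.encode q.num) q.den := rfl

lemma enc_int_nat (n : ℕ) : Encodable.encode (Int.ofNat n) = 2 * n := rfl
lemma enc_int_neg (n : ℕ) : Encodable.encode (Int.negSucc n) = 2 * n + 1 := rfl

lemma enc_natAbs (z : ℤ) : z.natAbs = (Encodable.encode z + 1) / 2 := by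
  cases z with
  | ofNat n => rw [enc_int_nat]; simp only [Int.ofNat_eq_natCast, Int.natAbs_natCast]; omega
  | negSucc n => rw [enc_int_neg]; simp only [Int.natAbs_negSucc]; omega

lemma mem_range_enc0 (m : ℕ) : (∃ q, enc0 q = m) ↔
    0 < m.unpair.2 ∧ Nat.Coprime ((m.unpair.1 + 1) / 2) m.unpair.2 := by
  constructor
  · rintro ⟨q, rfl⟩
    rw [enc0_eq]
    simp only [Nat.unpair_pair]
    rw [← enc_natAbs]
    exact ⟨q.den_pos, q.reduced⟩
  · rintro ⟨h1, h2⟩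
    have e : Encodable.encode (Denumerable.ofNat ℤ m.unpair.1) = m.unpair.1 :=
      Denumerable.encode_ofNat _
    refine ⟨⟨Denumerable.ofNat ℤ m.unpair.1, m.unpair.2, h1.ne', ?_⟩, ?_⟩
    · rw [enc_natAbs, e]; exact h2
    · rw [enc0_eq]
      change Nat.pair (Encodable.encode (Denumerable.ofNat ℤ m.unpair.1)) m.unpair.2 = m
      rw [e, Nat.pair_unpair]

lemma cp_S : CP (fun m : ℕ => ∃ q, enc0 q = m) := by
  have h1 : CP (fun m : ℕ => ∀ g < m.unpair.2 + 1,
      g = 1 ∨ ¬ ((m.unpair.1 + 1) / 2) % g = 0 ∨ ¬ m.unpair.2 % g = 0) := by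
    refine CP.ball (p := fun m g => g = 1 ∨ ¬ ((m.unpair.1 + 1) / 2) % g = 0 ∨
      ¬ m.unpair.2 % g = 0) ?_ (c_nadd (c_unpair2 Computable.id) (Computable.const 1))
    refine (CP.eq Computable.snd (Computable.const 1)).or ((CP.not (CP.eq (c_nmod (c_ndiv (c_nadd
      (c_unpair1 Computable.fst) (Computable.const 1)) (Computable.const 2)) Computable.snd)
      (Computable.const 0))).or (CP.not (CP.eq (c_nmod (c_unpair2 Computable.fst) Computable.snd)
      (Computable.const 0))))
  refine ((CP.nlt (Computable.const 0) (c_unpair2 Computable.id)).and h1).of_iff fun m => ?_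
  rw [mem_range_enc0]
  simp only [id]
  refine and_congr_right fun hpos => ?_
  constructor
  · intro h
    have h2 := h (Nat.gcd ((m.unpair.1 + 1) / 2) m.unpair.2)
      (Nat.lt_succ_of_le (Nat.le_of_dvd hpos (Nat.gcd_dvd_right _ _)))
    rcases h2 with h2 | h2 | h2
    · exact h2
    · exact absurd (Nat.mod_eq_zero_of_dvd (Nat.gcd_dvd_left _ _)) h2
    · exact absurd (Nat.mod_eq_zero_of_dvd (Nat.gcd_dvd_right _ _)) h2
  · intro h g hg
    by_contra hcon
    push Not at hcon
    exact hcon.1 (Nat.eq_one_of_dvd_coprimes h (Nat.dvd_of_mod_eq_zero hcon.2.1)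
      (Nat.dvd_of_mod_eq_zero hcon.2.2))

lemma enc_eq_count [inst : DecidablePred (fun m => ∃ q, enc0 q = m)] (q : ℚ) :
    @Encodable.encode ℚ (Primcodable.ofDenumerable ℚ).toEncodable q =
      Nat.count (fun m => ∃ q, enc0 q = m) (enc0 q) := by
  rw [Nat.count_eq_card_filter_range]
  have : inst = @Encodable.decidableRangeEncode ℚ Rat.instEncodable := Subsingleton.elim _ _
  subst this
  have key : @Encodable.encode ℚ (Primcodable.ofDenumerable ℚ).toEncodable q =
      (List.range (enc0 q)).countP (fun m => @decide (∃ q, enc0 q = m)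
        (@Encodable.decidableRangeEncode ℚ Rat.instEncodable m)) := by
    with_unfolding_all rfl
  rw [key, List.countP_eq_length_filter]
  rfl

lemma c_enc0 : Computable enc0 := by
  classical
  have hc : Computable (fun n => Nat.count (fun m => ∃ q, enc0 q = m) n) := by
    have := Computable.nat_rec (α := ℕ) (f := fun n => n) (g := fun _ => 0)
      (h := fun _ x => x.2 + if ∃ q, enc0 q = x.1 then 1 else 0) Computable.id
      (Computable.const 0) (Computable₂.mk (c_nadd (Computable.snd.comp Computable.snd)
        ((cp_S.comp (Computable.fst.comp Computable.snd)).ite (Computable.const 1)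
          (Computable.const 0))))
    refine this.of_eq fun n => ?_
    induction n with
    | zero => simp
    | succ n ih => rw [Nat.count_succ, ← ih]
  apply CP.graph
  refine ((cp_S.comp (Computable.snd (α := ℚ))).and (CP.eq (hc.comp Computable.snd)
    (Computable.encode.comp Computable.fst))).of_iff ?_
  rintro ⟨q, m⟩
  simp only
  constructor
  · rintro ⟨h1, h2⟩
    rw [enc_eq_count] at h2
    exact (Nat.count_injective (p := fun m => ∃ q, enc0 q = m) h1 ⟨q, rfl⟩ h2).symm
  · rintro rfl
    exact ⟨⟨q, rfl⟩, (enc_eq_count q).symm⟩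

/-- positive part of the numerator -/
def rP (q : ℚ) : ℕ := q.num.toNat
/-- negative part of the numerator -/
def rN (q : ℚ) : ℕ := (-q.num).toNat

lemma c_den : Computable (fun q : ℚ => q.den) :=
  (c_unpair2 c_enc0).of_eq fun q => by simp [enc0_eq]

lemma c_num : Computable (fun q : ℚ => Encodable.encode q.num) :=
  (c_unpair1 c_enc0).of_eq fun q => by simp [enc0_eq]

lemma c_rP : Computable rP := by
  refine ((CP.eq (c_nmod c_num (Computable.const 2)) (Computable.const 0)).ite
    (c_ndiv c_num (Computable.const 2)) (Computable.const 0)).of_eq fun q => ?_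
  rw [rP]
  cases q.num with
  | ofNat n => rw [enc_int_nat]; simp
  | negSucc n =>
    rw [enc_int_neg, if_neg (by omega)]
    omega

lemma c_rN : Computable rN := by
  refine ((CP.eq (c_nmod c_num (Computable.const 2)) (Computable.const 0)).ite
    (Computable.const 0) (c_ndiv (c_nadd c_num (Computable.const 1)) (Computable.const 2))).of_eq
    fun q => ?_
  rw [rN]
  cases q.num with
  | ofNat n => rw [enc_int_nat]; simp
  | negSucc n =>
    rw [enc_int_neg, if_neg (by omega)]
    omega

lemma r_spec (q : ℚ) : q * q.den = rP q - rN q := by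
  have h : (q.num : ℚ) = rP q - rN q := by
    have : q.num = (rP q : ℤ) - rN q := by simp only [rP, rN]; omega
    exact_mod_cast congrArg (Int.cast (R := ℚ)) this
  rw [← h]; exact Rat.mul_den_eq_num q

lemma den_pos' (q : ℚ) : (0 : ℚ) < q.den := by exact_mod_cast q.den_pos

lemma num_add (q r w : ℚ) :
    rP q * (r.den * w.den) + rP r * (q.den * w.den) + rN w * (q.den * r.den) =
      rN q * (r.den * w.den) + rN r * (q.den * w.den) + rP w * (q.den * r.den) ↔ q + r = w := by
  rw [← Nat.cast_inj (R := ℚ)]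
  push_cast
  have hq := r_spec q
  have hr := r_spec r
  have hw := r_spec w
  have h0 : (q.den : ℚ) * r.den * w.den ≠ 0 :=
    (mul_pos (mul_pos (den_pos' q) (den_pos' r)) (den_pos' w)).ne'
  have key : ((rP q : ℚ) * (r.den * w.den) + rP r * (q.den * w.den) + rN w * (q.den * r.den)) -
      (rN q * (r.den * w.den) + rN r * (q.den * w.den) + rP w * (q.den * r.den)) =
      (q + r - w) * (q.den * r.den * w.den) := by
    linear_combination (-(r.den : ℚ) * w.den) * hq - (q.den : ℚ) * w.den * hr
      + (q.den : ℚ) * r.den * hw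
  rw [← sub_eq_zero, key, mul_eq_zero, or_iff_left h0, sub_eq_zero]

lemma num_mul (q r w : ℚ) :
    (rP q * rP r + rN q * rN r) * w.den + rN w * (q.den * r.den) =
      (rP q * rN r + rN q * rP r) * w.den + rP w * (q.den * r.den) ↔ q * r = w := by
  rw [← Nat.cast_inj (R := ℚ)]
  push_cast
  have hq := r_spec q
  have hr := r_spec r
  have hw := r_spec w
  have h0 : (q.den : ℚ) * r.den * w.den ≠ 0 :=
    (mul_pos (mul_pos (den_pos' q) (den_pos' r)) (den_pos' w)).ne'
  have key : (((rP q : ℚ) * rP r + rN q * rN r) * w.den + rN w * (q.den * r.den)) -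
      ((rP q * rN r + rN q * rP r) * w.den + rP w * (q.den * r.den)) =
      (q * r - w) * (q.den * r.den * w.den) := by
    linear_combination (-(r * r.den) * (w.den : ℚ)) * hq - ((rP q : ℚ) - rN q) * w.den * hr
      + (q.den : ℚ) * r.den * hw
  rw [← sub_eq_zero, key, mul_eq_zero, or_iff_left h0, sub_eq_zero]

lemma num_lt (q r : ℚ) :
    rP q * r.den + rN r * q.den < rP r * q.den + rN q * r.den ↔ q < r := by
  rw [← Nat.cast_lt (α := ℚ)]
  push_cast
  have hq := r_spec q
  have hr := r_spec r
  have h0 : (0 : ℚ) < (q.den : ℚ) * r.den := mul_pos (den_pos' q) (den_pos' r)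
  have key : ((rP r : ℚ) * q.den + rN q * r.den) - (rP q * r.den + rN r * q.den) =
      (r - q) * (q.den * r.den) := by
    linear_combination (r.den : ℚ) * hq - (q.den : ℚ) * hr
  rw [← sub_pos, key, mul_pos_iff_of_pos_right h0, sub_pos]

set_option maxHeartbeats 400000 in
lemma c_add {f g : α → ℚ} (hf : Computable f) (hg : Computable g) :
    Computable (fun a => f a + g a) := by
  have key : Computable (fun x : ℚ × ℚ => x.1 + x.2) := by
    apply CP.graph
    have A : Computable (fun x : (ℚ × ℚ) × ℚ => x.1.1) := Computable.fst.comp Computable.fst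
    have B : Computable (fun x : (ℚ × ℚ) × ℚ => x.1.2) := Computable.snd.comp Computable.fst
    have C : Computable (fun x : (ℚ × ℚ) × ℚ => x.2) := Computable.snd
    have dA := c_den.comp A
    have dB := c_den.comp B
    have dC := c_den.comp C
    refine (CP.eq
      (c_nadd (c_nadd (c_nmul (c_rP.comp A) (c_nmul dB dC)) (c_nmul (c_rP.comp B) (c_nmul dA dC)))
        (c_nmul (c_rN.comp C) (c_nmul dA dB)))
      (c_nadd (c_nadd (c_nmul (c_rN.comp A) (c_nmul dB dC)) (c_nmul (c_rN.comp B) (c_nmul dA dC)))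
        (c_nmul (c_rP.comp C) (c_nmul dA dB)))).of_iff ?_
    exact fun x => num_add x.1.1 x.1.2 x.2
  exact Computable.comp (f := fun x : ℚ × ℚ => x.1 + x.2) (g := fun a => (f a, g a)) key
    (hf.pair hg)

set_option maxHeartbeats 400000 in
lemma c_mul {f g : α → ℚ} (hf : Computable f) (hg : Computable g) :
    Computable (fun a => f a * g a) := by
  have key : Computable (fun x : ℚ × ℚ => x.1 * x.2) := by
    apply CP.graph
    have A : Computable (fun x : (ℚ × ℚ) × ℚ => x.1.1) := Computable.fst.comp Computable.fst
    have B : Computable (fun x : (ℚ × ℚ) × ℚ => x.1.2) := Computable.snd.comp Computable.fst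
    have C : Computable (fun x : (ℚ × ℚ) × ℚ => x.2) := Computable.snd
    have dA := c_den.comp A
    have dB := c_den.comp B
    have dC := c_den.comp C
    have pA := c_rP.comp A
    have pB := c_rP.comp B
    have nA := c_rN.comp A
    have nB := c_rN.comp B
    refine (CP.eq
      (c_nadd (c_nmul (c_nadd (c_nmul pA pB) (c_nmul nA nB)) dC)
        (c_nmul (c_rN.comp C) (c_nmul dA dB)))
      (c_nadd (c_nmul (c_nadd (c_nmul pA nB) (c_nmul nA pB)) dC)
        (c_nmul (c_rP.comp C) (c_nmul dA dB)))).of_iff ?_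
    exact fun x => num_mul x.1.1 x.1.2 x.2
  exact Computable.comp (f := fun x : ℚ × ℚ => x.1 * x.2) (g := fun a => (f a, g a)) key
    (hf.pair hg)

lemma CP.lt {f g : α → ℚ} (hf : Computable f) (hg : Computable g) : CP (fun a => f a < g a) := by
  refine (CP.nlt
    (c_nadd (c_nmul (c_rP.comp hf) (c_den.comp hg)) (c_nmul (c_rN.comp hg) (c_den.comp hf)))
    (c_nadd (c_nmul (c_rP.comp hg) (c_den.comp hf)) (c_nmul (c_rN.comp hf) (c_den.comp hg)))).of_iff
    fun a => num_lt (f a) (g a)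

lemma CP.le {f g : α → ℚ} (hf : Computable f) (hg : Computable g) : CP (fun a => f a ≤ g a) :=
  (CP.lt hg hf).not.of_iff fun _ => not_lt

lemma c_pam {a1 b1 a2 b2 c x : α → ℚ} (h1 : Computable a1) (h2 : Computable b1)
    (h3 : Computable a2) (h4 : Computable b2) (h5 : Computable c) (hx : Computable x) :
    Computable (fun a => pam2 (a1 a) (b1 a) (a2 a) (b2 a) (c a) (x a)) := by
  unfold pam2
  exact ((CP.le (Computable.const 0) hx).and (CP.lt hx h5)).ite (c_add (c_mul h1 hx) h2)
    (((CP.le h5 hx).and (CP.lt hx (Computable.const 1))).ite (c_add (c_mul h3 hx) h4)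
      (Computable.const 0))

lemma c_iter {a1 b1 a2 b2 c x : α → ℚ} {n : α → ℕ} (h1 : Computable a1) (h2 : Computable b1)
    (h3 : Computable a2) (h4 : Computable b2) (h5 : Computable c) (hx : Computable x)
    (hn : Computable n) :
    Computable (fun a => (pam2 (a1 a) (b1 a) (a2 a) (b2 a) (c a))^[n a] (x a)) := by
  have F : Computable (fun y : α × (ℕ × ℚ) => y.1) := Computable.fst
  have := Computable.nat_rec (h := fun a y => pam2 (a1 a) (b1 a) (a2 a) (b2 a) (c a) y.2) hn hx
    (Computable₂.mk (c_pam (h1.comp F) (h2.comp F) (h3.comp F) (h4.comp F) (h5.comp F)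
      (Computable.snd.comp Computable.snd)))
  refine this.of_eq fun a => ?_
  generalize n a = k
  induction k with
  | zero => rfl
  | succ k ih => rw [Function.iterate_succ_apply', ← ih]

lemma cp_good {a1 b1 a2 b2 c : α → ℚ} (h1 : Computable a1) (h2 : Computable b1)
    (h3 : Computable a2) (h4 : Computable b2) (h5 : Computable c) :
    CP (fun a => Good (a1 a) (b1 a) (a2 a) (b2 a) (c a)) := by
  have k0 : Computable (fun _ : α => (0 : ℚ)) := Computable.const 0
  have k1 : Computable (fun _ : α => (1 : ℚ)) := Computable.const 1
  refine ((CP.lt k0 h5).and <| (CP.lt h5 k1).and <| (CP.lt h3 k0).and <| (CP.lt k0 h1).and <|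
    (CP.le h2 h5).and <| (CP.lt h5 (c_add (c_mul h1 h5) h2)).and <|
    (CP.le (c_add (c_mul h1 h5) h2) k1).and <| (CP.le k0 (c_add h3 h4)).and <|
    (CP.lt (c_add (c_mul h3 h5) h4) h2)).of_iff fun a => ?_
  constructor
  · rintro ⟨g1, g2, g3, g4, g5, g6, g7, g8, g9⟩
    exact ⟨g1, g2, g3, g4, g5, g6, g7, g8, g9⟩
  · rintro ⟨g1, g2, g3, g4, g5, g6, g7, g8, g9⟩
    exact ⟨g1, g2, g3, g4, g5, g6, g7, g8, g9⟩

set_option maxHeartbeats 400000 in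
lemma cp_cert {c t : α → ℚ} {z : α → ℕ → ℚ} {m k : α → ℕ} (hc : Computable c) (ht : Computable t)
    (hz : Computable (fun x : α × ℕ => z x.1 x.2)) (hm : Computable m) (hk : Computable k) :
    CP (fun a => Cert (c a) (t a) (z a) (m a) (k a)) := by
  have F : Computable (fun x : α × ℕ => x.1) := Computable.fst
  have J : Computable (fun x : α × ℕ => x.2) := Computable.snd
  have mk : Computable (fun a => m a + k a) := c_nadd hm hk
  have mkk : Computable (fun a => m a + k a + k a) := c_nadd mk hk
  have mj : Computable (fun x : α × ℕ => m x.1 + x.2) := c_nadd (hm.comp F) J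
  have mjk : Computable (fun x : α × ℕ => m x.1 + x.2 + k x.1) := c_nadd mj (hk.comp F)
  have z0 : Computable (fun a => z a (m a)) :=
    Computable.comp (f := fun x : α × ℕ => z x.1 x.2) (g := fun a => (a, m a)) hz
      (Computable.id.pair hm)
  have z1 : Computable (fun a => z a (m a + k a)) :=
    Computable.comp (f := fun x : α × ℕ => z x.1 x.2) (g := fun a => (a, m a + k a)) hz
      (Computable.id.pair mk)
  have z2 : Computable (fun a => z a (m a + k a + k a)) :=
    Computable.comp (f := fun x : α × ℕ => z x.1 x.2) (g := fun a => (a, m a + k a + k a)) hz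
      (Computable.id.pair mkk)
  have y0 : Computable (fun x : α × ℕ => z x.1 (m x.1 + x.2)) :=
    Computable.comp (f := fun x : α × ℕ => z x.1 x.2) (g := fun x : α × ℕ => (x.1, m x.1 + x.2)) hz
      (F.pair mj)
  have y1 : Computable (fun x : α × ℕ => z x.1 (m x.1 + x.2 + k x.1)) :=
    Computable.comp (f := fun x : α × ℕ => z x.1 x.2) (g := fun x : α × ℕ => (x.1, m x.1 + x.2 + k x.1)) hz
      (F.pair mjk)
  have cF : Computable (fun x : α × ℕ => c x.1) := hc.comp F
  have tF : Computable (fun x : α × ℕ => t x.1) := ht.comp F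
  unfold Cert
  refine (((CP.le z0 z2).and (CP.le z2 z1)).or ((CP.le z1 z2).and (CP.le z2 z0))).and ?_
  refine CP.ball (p := fun a j => ((z a (m a + j) < c a ∧ z a (m a + j + k a) < c a) ∨
      (c a ≤ z a (m a + j) ∧ c a ≤ z a (m a + j + k a))) ∧
    ((z a (m a + j) < t a ∧ z a (m a + j + k a) < t a) ∨
      (t a < z a (m a + j) ∧ t a < z a (m a + j + k a)))) ?_ hk
  exact (((CP.lt y0 cF).and (CP.lt y1 cF)).or ((CP.le cF y0).and (CP.le cF y1))).and
    (((CP.lt y0 tF).and (CP.lt y1 tF)).or ((CP.lt tF y0).and (CP.lt tF y1)))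

/-- The stopping condition of the search, at search index `w = (m, k)`. -/
def Stop (a1 b1 a2 b2 c x t : ℚ) (w : ℕ) : Prop :=
  ¬ (Good a1 b1 a2 b2 c ∧ 0 ≤ x ∧ x < 1) ∨ (0 < w.unpair.2 ∧
    ((pam2 a1 b1 a2 b2 c)^[w.unpair.2] t = t ∨ (pam2 a1 b1 a2 b2 c)^[w.unpair.2] x = x ∨
      Cert c t (fun n => (pam2 a1 b1 a2 b2 c)^[n] x) w.unpair.1 w.unpair.2))

lemma cp_stop {a1 b1 a2 b2 c x t : α → ℚ} {w : α → ℕ} (h1 : Computable a1) (h2 : Computable b1)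
    (h3 : Computable a2) (h4 : Computable b2) (h5 : Computable c) (hx : Computable x)
    (ht : Computable t) (hw : Computable w) :
    CP (fun a => Stop (a1 a) (b1 a) (a2 a) (b2 a) (c a) (x a) (t a) (w a)) := by
  have k : Computable (fun a => (w a).unpair.2) := c_unpair2 hw
  have m : Computable (fun a => (w a).unpair.1) := c_unpair1 hw
  have F : Computable (fun y : α × ℕ => y.1) := Computable.fst
  have g1 : CP (fun a => Good (a1 a) (b1 a) (a2 a) (b2 a) (c a) ∧ 0 ≤ x a ∧ x a < 1) :=
    (cp_good h1 h2 h3 h4 h5).and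
      ((CP.le (Computable.const 0) hx).and (CP.lt hx (Computable.const 1)))
  have g2 : CP (fun a => (pam2 (a1 a) (b1 a) (a2 a) (b2 a) (c a))^[(w a).unpair.2] (t a) = t a) :=
    CP.eq (c_iter h1 h2 h3 h4 h5 ht k) ht
  have g3 : CP (fun a => (pam2 (a1 a) (b1 a) (a2 a) (b2 a) (c a))^[(w a).unpair.2] (x a) = x a) :=
    CP.eq (c_iter h1 h2 h3 h4 h5 hx k) hx
  have g4 : Computable (fun y : α × ℕ =>
      (pam2 (a1 y.1) (b1 y.1) (a2 y.1) (b2 y.1) (c y.1))^[y.2] (x y.1)) :=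
    c_iter (h1.comp F) (h2.comp F) (h3.comp F) (h4.comp F) (h5.comp F) (hx.comp F) Computable.snd
  have g5 := cp_cert (z := fun a n => (pam2 (a1 a) (b1 a) (a2 a) (b2 a) (c a))^[n] (x a))
    h5 ht g4 m k
  have g6 : CP (fun a => 0 < (w a).unpair.2) := CP.nlt (Computable.const 0) k
  exact g1.not.or (g6.and (g2.or (g3.or g5)))

lemma Stop.exists (a1 b1 a2 b2 c x t : ℚ) : ∃ w, Stop a1 b1 a2 b2 c x t w := by
  by_cases hg : Good a1 b1 a2 b2 c ∧ 0 ≤ x ∧ x < 1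
  · obtain ⟨m, k, hk, h⟩ := hg.1.complete (t := t) ⟨hg.2.1, hg.2.2⟩
    refine ⟨Nat.pair m k, Or.inr ?_⟩
    simp only [Nat.unpair_pair]
    exact ⟨hk, h⟩
  · exact ⟨0, Or.inl hg⟩

lemma Stop.spec {a1 b1 a2 b2 c x t : ℚ} {w : ℕ} (hst : Stop a1 b1 a2 b2 c x t w)
    (hgood : Good a1 b1 a2 b2 c) (hx : x ∈ Set.Ico (0 : ℚ) 1) (ht : t ∈ Set.Ico (0 : ℚ) 1) :
    (¬ ∀ i < w.unpair.1 + w.unpair.2, ¬ (pam2 a1 b1 a2 b2 c)^[i] x = t) ↔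
      ∃ n : ℕ, (pam2 a1 b1 a2 b2 c)^[n] x = t := by
  push Not
  constructor
  · rintro ⟨i, _, hi⟩
    exact ⟨i, hi⟩
  · rintro ⟨n, hn⟩
    rcases hst with hst | ⟨hk, hst | hst | hst⟩
    · exact absurd ⟨hgood, hx.1, hx.2⟩ hst
    · obtain ⟨i, hi, h⟩ := hgood.sound_t hx ht hk hst hn
      exact ⟨i, by omega, h⟩
    · obtain ⟨i, hi, h⟩ := sound_x hk hst hn
      exact ⟨i, by omega, h⟩
    · have := hgood.sound_cert hx hk hst hn
      exact ⟨n, by omega, hn⟩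

lemma main_generic {a1 b1 a2 b2 c x t : α → ℚ} (h1 : Computable a1) (h2 : Computable b1)
    (h3 : Computable a2) (h4 : Computable b2) (h5 : Computable c) (hx : Computable x)
    (ht : Computable t) : ∃ b : α → Bool, Computable b ∧ ∀ a,
      Good (a1 a) (b1 a) (a2 a) (b2 a) (c a) → x a ∈ Set.Ico (0 : ℚ) 1 →
      t a ∈ Set.Ico (0 : ℚ) 1 →
      (b a = true ↔ ∃ n : ℕ, (pam2 (a1 a) (b1 a) (a2 a) (b2 a) (c a))^[n] (x a) = t a) := by
  have F : Computable (fun y : α × ℕ => y.1) := Computable.fst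
  have hs : CP (fun y : α × ℕ =>
      Stop (a1 y.1) (b1 y.1) (a2 y.1) (b2 y.1) (c y.1) (x y.1) (t y.1) y.2) :=
    cp_stop (h1.comp F) (h2.comp F) (h3.comp F) (h4.comp F) (h5.comp F) (hx.comp F) (ht.comp F)
      Computable.snd
  obtain ⟨w, hw, hw'⟩ := CP.find
    (p := fun a n => Stop (a1 a) (b1 a) (a2 a) (b2 a) (c a) (x a) (t a) n) hs
    (fun a => Stop.exists _ _ _ _ _ _ _)
  have g4 : Computable (fun y : α × ℕ =>
      (pam2 (a1 y.1) (b1 y.1) (a2 y.1) (b2 y.1) (c y.1))^[y.2] (x y.1)) :=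
    c_iter (h1.comp F) (h2.comp F) (h3.comp F) (h4.comp F) (h5.comp F) (hx.comp F) Computable.snd
  have hhit : CP (fun a => ¬ ∀ i < (w a).unpair.1 + (w a).unpair.2,
      ¬ (pam2 (a1 a) (b1 a) (a2 a) (b2 a) (c a))^[i] (x a) = t a) :=
    (CP.ball (p := fun a i => ¬ (pam2 (a1 a) (b1 a) (a2 a) (b2 a) (c a))^[i] (x a) = t a)
      (CP.eq g4 (ht.comp F)).not (c_nadd (c_unpair1 hw) (c_unpair2 hw))).not
  obtain ⟨b, hb, hb'⟩ := hhit
  exact ⟨b, hb, fun a hg hxa hta => (hb' a).trans ((hw' a).spec hg hxa hta)⟩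

end Comp

lemma good_of_hyps {a1 b1 a2 b2 c : ℚ} (c0 : 0 < c) (c1 : c < 1)
    (hmap : ∀ x ∈ Set.Ico (0 : ℚ) 1, pam2 a1 b1 a2 b2 c x ∈ Set.Ico (0 : ℚ) 1)
    (htw : ∀ x ∈ Set.Ico c 1, ∀ y ∈ Set.Ico (0 : ℚ) c,
          pam2 a1 b1 a2 b2 c x < pam2 a1 b1 a2 b2 c y)
    (ha2 : a2 < 0) (ha1 : 0 < a1) (hb : b1 ≤ c) (hc : c < a1 * c + b1) :
    Good a1 b1 a2 b2 c := by
  refine ⟨c0, c1, ha2, ha1, hb, hc, ?_, ?_, ?_⟩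
  · by_contra hcon
    push Not at hcon
    obtain ⟨x, hx1, hx2⟩ := exists_between
      (show max 0 ((1 - b1) / a1) < c from max_lt c0 (by rw [div_lt_iff₀ ha1]; linarith))
    rw [max_lt_iff, div_lt_iff₀ ha1] at hx1
    have := (hmap x ⟨hx1.1.le, hx2.trans c1⟩).2
    rw [f_left hx1.1.le hx2] at this
    linarith [hx1.2]
  · by_contra hcon
    push Not at hcon
    obtain ⟨x, hx1, hx2⟩ := exists_between
      (show max c (b2 / (-a2)) < 1 from max_lt c1 (by rw [div_lt_iff₀ (by linarith)]; linarith))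
    rw [max_lt_iff, div_lt_iff₀ (by linarith)] at hx1
    have := (hmap x ⟨c0.le.trans hx1.1.le, hx2⟩).1
    rw [f_right hx1.1.le hx2] at this
    linarith [hx1.2]
  · have := htw c ⟨le_rfl, c1⟩ 0 ⟨le_rfl, c0⟩
    rw [f_right le_rfl c1, f_left le_rfl c0] at this
    linarith

end PamAux


/-- Reachability is decidable for injective two-interval PAM satisfying the twist
condition with `a2 < 0 < a1` and cutpoint `c ∈ f([0,c))`. -/
theorem pam_reachability_decidable_neg_slope_cut_in_f1 :
    ∃ F : ℚ × ℚ × ℚ × ℚ × ℚ × ℚ × ℚ → Bool, Computable F ∧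
      ∀ a1 b1 a2 b2 c x0 t : ℚ,
        0 < c → c < 1 →
        (∀ x ∈ Set.Ico (0 : ℚ) 1, pam2 a1 b1 a2 b2 c x ∈ Set.Ico (0 : ℚ) 1) →
        Set.InjOn (pam2 a1 b1 a2 b2 c) (Set.Ico (0 : ℚ) 1) →
        (∀ x ∈ Set.Ico c 1, ∀ y ∈ Set.Ico (0 : ℚ) c,
          pam2 a1 b1 a2 b2 c x < pam2 a1 b1 a2 b2 c y) →
        a2 < 0 → 0 < a1 →
        b1 ≤ c → c < a1 * c + b1 →
        x0 ∈ Set.Ico (0 : ℚ) 1 → t ∈ Set.Ico (0 : ℚ) 1 →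
        (F (a1, b1, a2, b2, c, x0, t) = true ↔
          ∃ n : ℕ, (pam2 a1 b1 a2 b2 c)^[n] x0 = t) := by
  -- projections
  have s1 : Computable (fun p : ℚ × ℚ × ℚ × ℚ × ℚ × ℚ × ℚ => p.2) := Computable.snd
  have s2 : Computable (fun p : ℚ × ℚ × ℚ × ℚ × ℚ × ℚ × ℚ => p.2.2) := Computable.snd.comp s1
  have s3 : Computable (fun p : ℚ × ℚ × ℚ × ℚ × ℚ × ℚ × ℚ => p.2.2.2) := Computable.snd.comp s2
  have s4 : Computable (fun p : ℚ × ℚ × ℚ × ℚ × ℚ × ℚ × ℚ => p.2.2.2.2) := Computable.snd.comp s3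
  have s5 : Computable (fun p : ℚ × ℚ × ℚ × ℚ × ℚ × ℚ × ℚ => p.2.2.2.2.2) := Computable.snd.comp s4
  have h1 : Computable (fun p : ℚ × ℚ × ℚ × ℚ × ℚ × ℚ × ℚ => p.1) := Computable.fst
  have h2 : Computable (fun p : ℚ × ℚ × ℚ × ℚ × ℚ × ℚ × ℚ => p.2.1) := Computable.fst.comp s1
  have h3 : Computable (fun p : ℚ × ℚ × ℚ × ℚ × ℚ × ℚ × ℚ => p.2.2.1) := Computable.fst.comp s2
  have h4 : Computable (fun p : ℚ × ℚ × ℚ × ℚ × ℚ × ℚ × ℚ => p.2.2.2.1) := Computable.fst.comp s3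
  have h5 : Computable (fun p : ℚ × ℚ × ℚ × ℚ × ℚ × ℚ × ℚ => p.2.2.2.2.1) := Computable.fst.comp s4
  have hx : Computable (fun p : ℚ × ℚ × ℚ × ℚ × ℚ × ℚ × ℚ => p.2.2.2.2.2.1) := Computable.fst.comp s5
  have ht : Computable (fun p : ℚ × ℚ × ℚ × ℚ × ℚ × ℚ × ℚ => p.2.2.2.2.2.2) := Computable.snd.comp s5
  obtain ⟨b, hb, hb'⟩ := PamAux.main_generic h1 h2 h3 h4 h5 hx ht
  refine ⟨b, hb, ?_⟩
  intro a1 b1 a2 b2 c x0 t c0 c1 hmap _ htw ha2 ha1 hbc hcL hx0 ht0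
  exact hb' (a1, b1, a2, b2, c, x0, t)
    (PamAux.good_of_hyps c0 c1 hmap htw ha2 ha1 hbc hcL) hx0 ht0
end
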